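/- arXiv:1611.08488 — 2 statements merged into one kernel-verified Lean document; each statement's English description precedes it below -/
import Mathlib

section
/- Let T : X → X be a cw-expansive homeomorphism of a compact metric space X. Then the set of f ∈ C(X, ℝ) that observe T is residual (comeager) in C(X, ℝ); in particular Obs(T) = 1. -/
open Set Topology Function Metric

/-- The observability number of `T : X → X`: the minimal `m ≥ 1` for which there exists a
continuous `f : X → ℝ^m` observing `T` (`⊤` if no such `m` exists). -/
noncomputable def obsNum {X : Type*} [TopologicalSpace X] (T : X → X) : ℕ∞ :=
  sInf {m : ℕ∞ | ∃ k : ℕ, m = (k : ℕ∞) ∧ 1 ≤ k ∧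
    ∃ f : C(X, EuclideanSpace ℝ (Fin k)),
      ∀ x y : X, x ≠ y → ∃ n : ℕ, f (T^[n] x) ≠ f (T^[n] y)}

universe u

/-- In a compact Hausdorff space, every neighbourhood of a connected component contains a clopen
neighbourhood of it. -/
lemma exists_isClopen_subset {Q : Type*} [TopologicalSpace Q] [CompactSpace Q] [T2Space Q]
    {x : Q} {U : Set Q} (hU : IsOpen U) (h : connectedComponent x ⊆ U) :
    ∃ V : Set Q, IsClopen V ∧ x ∈ V ∧ V ⊆ U := by
  rw [connectedComponent_eq_iInter_isClopen] at h
  have : Nonempty { s : Set Q // IsClopen s ∧ x ∈ s } := ⟨⟨univ, isClopen_univ, mem_univ _⟩⟩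
  obtain ⟨⟨V, hV⟩, hVU⟩ := exists_subset_nhds_of_isCompact
    (V := fun s : { s : Set Q // IsClopen s ∧ x ∈ s } => (s : Set Q))
    (fun a b => ⟨⟨a.1 ∩ b.1, a.2.1.inter b.2.1, a.2.2, b.2.2⟩, inter_subset_left,
      inter_subset_right⟩) (fun s => s.2.1.isClosed.isCompact)
    (fun z hz => hU.mem_nhds (h hz))
  exact ⟨V, hV.1, hV.2, hVU⟩

/-- Boundary bumping: a continuum escaping a sublevel set of `φ` contains a subcontinuum through a
prescribed point of the sublevel set that stays inside it and reaches its boundary. -/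
lemma exists_subcontinuum {X : Type*} [TopologicalSpace X] [T2Space X] {C : Set X}
    (hC : IsCompact C) (hconn : IsPreconnected C) {φ : X → ℝ} (hφ : Continuous φ) {r : ℝ}
    {x y : X} (hx : x ∈ C) (hxr : φ x ≤ r) (hy : y ∈ C) (hyr : r < φ y) :
    ∃ D ⊆ C, IsCompact D ∧ IsPreconnected D ∧ x ∈ D ∧ (∀ z ∈ D, φ z ≤ r) ∧ ∃ z ∈ D, φ z = r := by
  set Q : Set X := C ∩ φ ⁻¹' Iic r with hQ
  have hQc : IsCompact Q := hC.inter_right (isClosed_Iic.preimage hφ)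
  have : CompactSpace Q := isCompact_iff_compactSpace.mp hQc
  let x' : Q := ⟨x, hx, hxr⟩
  refine ⟨Subtype.val '' connectedComponent x', ?_, ?_, ?_, ?_, ?_, ?_⟩
  · rintro _ ⟨z, -, rfl⟩
    exact z.2.1
  · exact isClosed_connectedComponent.isCompact.image continuous_subtype_val
  · exact isPreconnected_connectedComponent.image _ continuous_subtype_val.continuousOn
  · exact ⟨x', mem_connectedComponent, rfl⟩
  · rintro _ ⟨z, -, rfl⟩
    exact z.2.2
  · by_contra! hne
    have hsub : connectedComponent x' ⊆ {z : Q | φ z < r} := fun z hz =>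
      lt_of_le_of_ne z.2.2 (hne _ ⟨z, hz, rfl⟩)
    have hop : IsOpen {z : Q | φ z < r} :=
      isOpen_lt (hφ.comp continuous_subtype_val) continuous_const
    obtain ⟨V, hV, hxV, hVs⟩ := exists_isClopen_subset hop hsub
    obtain ⟨O, hO, hOV⟩ := isOpen_induced_iff.mp hV.isOpen
    have hVc : IsClosed (Subtype.val '' V) :=
      (hV.isClosed.isCompact.image continuous_subtype_val).isClosed
    have hmem : ∀ z (hz : z ∈ Q), z ∈ O → (⟨z, hz⟩ : Q) ∈ V := fun z hz hzO => by
      rw [← hOV]; exact hzO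
    obtain ⟨z, hzC, hz1, hz2⟩ := hconn (O ∩ {z | φ z < r}) (Subtype.val '' V)ᶜ
      (hO.inter (isOpen_lt hφ continuous_const)) hVc.isOpen_compl
      (fun z hz => by
        by_cases hzV : z ∈ Subtype.val '' V
        · left
          obtain ⟨w, hw, rfl⟩ := hzV
          exact ⟨by rw [← hOV] at hw; exact hw, hVs hw⟩
        · right; exact hzV)
      ⟨x, hx, by rw [← hOV] at hxV; exact hxV, hVs hxV⟩
      ⟨y, hy, by rintro ⟨w, hw, rfl⟩; exact absurd w.2.2 (not_le.mpr hyr)⟩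
    exact hz2 ⟨⟨z, hzC, le_of_lt (show φ z < r from hz1.2)⟩, hmem z _ hz1.1, rfl⟩

/-- The limit of a sequence of sets along an ultrafilter. -/
def ultraLimit {X : Type*} [TopologicalSpace X] (ω : Ultrafilter ℕ) (C : ℕ → Set X) : Set X :=
  {x | ∀ U ∈ 𝓝 x, ∀ᶠ k in (ω : Filter ℕ), (C k ∩ U).Nonempty}

lemma isClosed_ultraLimit {X : Type*} [TopologicalSpace X] (ω : Ultrafilter ℕ)
    (C : ℕ → Set X) : IsClosed (ultraLimit ω C) := by
  refine isClosed_of_closure_subset fun x hx U hU => ?_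
  obtain ⟨V, hVU, hV, hxV⟩ := mem_nhds_iff.mp hU
  obtain ⟨y, hyV, hy⟩ := mem_closure_iff.mp hx V hV hxV
  exact (hy V (hV.mem_nhds hyV)).mono fun k hk => hk.mono (inter_subset_inter_right _ hVU)

lemma exists_mem_ultraLimit {X : Type*} [TopologicalSpace X] [CompactSpace X] {ω : Ultrafilter ℕ}
    {C : ℕ → Set X} {z : ℕ → X} (hz : ∀ᶠ k in (ω : Filter ℕ), z k ∈ C k) :
    ∃ x ∈ ultraLimit ω C, Filter.Tendsto z ω (𝓝 x) := by
  have h : Filter.Tendsto z ω (𝓝 (ω.map z).lim) := (ω.map z).le_nhds_lim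
  exact ⟨_, fun U hU => (hz.and (h.eventually hU)).mono fun k hk => ⟨z k, hk⟩, h⟩

lemma isPreconnected_ultraLimit {X : Type*} [TopologicalSpace X] [CompactSpace X] [T2Space X]
    {ω : Ultrafilter ℕ} {C : ℕ → Set X} (hC : ∀ᶠ k in (ω : Filter ℕ), IsPreconnected (C k)) :
    IsPreconnected (ultraLimit ω C) := by
  rw [isPreconnected_closed_iff]
  intro s t hs ht hst hsL htL
  by_contra hne
  have hdisj : Disjoint (ultraLimit ω C ∩ s) (ultraLimit ω C ∩ t) := by
    rw [Set.disjoint_left]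
    exact fun x hx hx' => hne ⟨x, hx.1, hx.2, hx'.2⟩
  have hL := isClosed_ultraLimit ω C
  obtain ⟨U, V, hU, hV, hsU, htV, hUV⟩ := normal_separation (hL.inter hs) (hL.inter ht) hdisj
  obtain ⟨x, hx⟩ := hsL
  obtain ⟨y, hy⟩ := htL
  have hev : ∀ᶠ k in (ω : Filter ℕ), ∃ z, z ∈ C k ∧ z ∈ (U ∪ V)ᶜ := by
    filter_upwards [hC, hx.1 U (hU.mem_nhds (hsU hx)), hy.1 V (hV.mem_nhds (htV hy))]
      with k hk hkU hkV
    by_contra! hcon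
    obtain ⟨z, -, hz⟩ := hk U V hU hV (fun z hz => not_not.mp (hcon z hz)) hkU hkV
    exact Set.disjoint_left.mp hUV hz.1 hz.2
  have : Nonempty X := ⟨x⟩
  obtain ⟨z, hz⟩ := hev.choice
  obtain ⟨w, hw, hzw⟩ := exists_mem_ultraLimit (hz.mono fun k hk => hk.1)
  have hwc : w ∈ (U ∪ V)ᶜ := (hU.union hV).isClosed_compl.mem_of_tendsto hzw
    (hz.mono fun k hk => hk.2)
  rcases hst hw with h | h
  · exact hwc (Or.inl (hsU ⟨hw, h⟩))
  · exact hwc (Or.inr (htV ⟨hw, h⟩))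

lemma dist_le_of_mem_ultraLimit {X : Type*} [MetricSpace X] {ω : Ultrafilter ℕ} {C : ℕ → Set X}
    {g : X → X} (hg : Continuous g) {δ : ℝ}
    (h : ∀ᶠ k in (ω : Filter ℕ), ∀ x ∈ C k, ∀ y ∈ C k, dist (g x) (g y) ≤ δ)
    {x y : X} (hx : x ∈ ultraLimit ω C) (hy : y ∈ ultraLimit ω C) : dist (g x) (g y) ≤ δ := by
  by_contra! hlt
  have hop : IsOpen {p : X × X | δ < dist (g p.1) (g p.2)} :=
    isOpen_lt continuous_const (by fun_prop)
  obtain ⟨U, hU, V, hV, hUV⟩ := mem_nhds_prod_iff.mp (hop.mem_nhds (x := (x, y)) hlt)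
  obtain ⟨k, hk, ⟨a, ha, haU⟩, ⟨b, hb, hbV⟩⟩ := (h.and ((hx U hU).and (hy V hV))).exists
  exact absurd (hk a ha b hb) (not_le.mpr (hUV (mk_mem_prod haU hbV)))

/-- A closed set all of whose subcontinua are small splits into finitely many small pieces. -/
lemma exists_finite_partition {X : Type u} [MetricSpace X] [CompactSpace X] {Q : Set X}
    (hQ : IsClosed Q) {η : ℝ}
    (h : ∀ C ⊆ Q, IsClosed C → IsPreconnected C → ∀ x ∈ C, ∀ y ∈ C, dist x y < η) :
    ∃ (ι : Type u) (_ : Finite ι) (E : ι → Set X), (∀ i, IsClosed (E i)) ∧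
      (∀ i j, i ≠ j → Disjoint (E i) (E j)) ∧ (⋃ i, E i) = Q ∧
      ∀ i, ∀ x ∈ E i, ∀ y ∈ E i, dist x y < 2 * η := by
  have : CompactSpace Q := isCompact_iff_compactSpace.mp hQ.isCompact
  have key : ∀ x : Q, ∃ V : Set Q, IsClopen V ∧ x ∈ V ∧ ∀ y ∈ V, dist x y < η := by
    intro x
    have hsub : connectedComponent x ⊆ ball x η := fun y hy => by
      rw [mem_ball']
      exact h (Subtype.val '' connectedComponent x) (by rintro _ ⟨z, -, rfl⟩; exact z.2)
        (isClosed_connectedComponent.isCompact.image continuous_subtype_val).isClosed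
        (isPreconnected_connectedComponent.image _ continuous_subtype_val.continuousOn)
        _ ⟨x, mem_connectedComponent, rfl⟩ _ ⟨y, hy, rfl⟩
    obtain ⟨V, hV, hxV, hVs⟩ := exists_isClopen_subset isOpen_ball hsub
    exact ⟨V, hV, hxV, fun y hy => by simpa [dist_comm] using hVs hy⟩
  choose V hV hxV hVη using key
  obtain ⟨t, ht⟩ := isCompact_univ.elim_finite_subcover V (fun x => (hV x).isOpen)
    (fun x _ => mem_iUnion.mpr ⟨x, hxV x⟩)
  refine ⟨Set t, inferInstance, fun S => Subtype.val '' {y : Q | ∀ x : t, y ∈ V x ↔ x ∈ S},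
    fun S => ?_, fun S S' hS => ?_, ?_, ?_⟩
  · refine (IsClosed.isCompact ?_).image continuous_subtype_val |>.isClosed
    rw [ofPred_forall]
    refine isClosed_iInter fun x => ?_
    by_cases hx : x ∈ S
    · simpa [hx] using (hV x).isClosed
    · simpa only [hx, iff_false] using! (hV x).isOpen.isClosed_compl
  · rw [Set.disjoint_left]
    rintro _ ⟨y, hy, rfl⟩ ⟨y', hy', he⟩
    obtain rfl := Subtype.val_injective he
    exact hS (Set.ext fun x => (hy x).symm.trans (hy' x))
  · ext y
    simp only [mem_iUnion]
    refine ⟨?_, fun hy => ⟨{x : t | (⟨y, hy⟩ : Q) ∈ V x}, ⟨y, hy⟩, fun x => Iff.rfl, rfl⟩⟩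
    rintro ⟨S, z, -, rfl⟩
    exact z.2
  · rintro S _ ⟨y, hy, rfl⟩ _ ⟨z, hz, rfl⟩
    obtain ⟨x, hxt, hyx⟩ := mem_iUnion₂.mp (ht (mem_univ y))
    have hzx : z ∈ V x := (hz ⟨x, hxt⟩).mpr ((hy ⟨x, hxt⟩).mp hyx)
    have h1 := hVη x y hyx
    have h2 := hVη x z hzx
    have h3 := dist_triangle_left y z x
    simp only [Subtype.dist_eq] at h1 h2 h3 ⊢
    linarith

lemma Homeomorph.zpow_add_apply {X : Type*} [TopologicalSpace X] (T : X ≃ₜ X) (i j : ℤ) (x : X) :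
    (T ^ (i + j)) x = (T ^ i) ((T ^ j) x) := by
  rw [zpow_add]; rfl

lemma Homeomorph.zpow_natCast_apply {X : Type*} [TopologicalSpace X] (T : X ≃ₜ X) (n : ℕ) (x : X) :
    (T ^ (n : ℤ)) x = T^[n] x := by
  induction n generalizing x with
  | zero => rfl
  | succ n ih => rw [Nat.cast_succ, zpow_add_apply, ih, zpow_one, iterate_succ_apply]

lemma Homeomorph.toEquiv_zpow_apply {X : Type*} [TopologicalSpace X] (T : X ≃ₜ X) (n : ℤ) (x : X) :
    (T.toEquiv ^ n) x = (T ^ n) x := by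
  let F : (X ≃ₜ X) →* Equiv.Perm X :=
    { toFun := Homeomorph.toEquiv, map_one' := rfl, map_mul' := fun _ _ => rfl }
  exact congrArg (fun e : Equiv.Perm X => e x) (map_zpow F T n).symm

/-- Cw-expansiveness with constant `δ`, phrased through pairwise distances. -/
def CwExpansiveWith {X : Type*} [MetricSpace X] (T : X ≃ₜ X) (δ : ℝ) : Prop :=
  ∀ C : Set X, IsClosed C → IsPreconnected C →
    (∀ n : ℤ, ∀ x ∈ C, ∀ y ∈ C, dist ((T ^ n) x) ((T ^ n) y) ≤ δ) → C.Subsingleton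

lemma cwExpansiveWith_of_diam {X : Type*} [MetricSpace X] [CompactSpace X] {T : X ≃ₜ X} {δ : ℝ}
    (hδ : 0 < δ) (h : ∀ C : Set X, IsCompact C → IsConnected C → C.Nontrivial →
      ∃ n : ℤ, δ < diam ((T.toEquiv ^ n) '' C)) : CwExpansiveWith T δ := by
  intro C hC hconn hsmall
  by_contra hne
  rw [Set.not_subsingleton_iff] at hne
  obtain ⟨n, hn⟩ := h C hC.isCompact ⟨hne.nonempty, hconn⟩ hne
  refine absurd hn (not_lt.mpr (diam_le_of_forall_dist_le hδ.le ?_))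
  rintro _ ⟨x, hx, rfl⟩ _ ⟨y, hy, rfl⟩
  rw [T.toEquiv_zpow_apply, T.toEquiv_zpow_apply]
  exact hsmall n x hx y hy

/-- Finitely many iterates are simultaneously uniformly continuous. -/
lemma exists_dist_iterate_lt {X Y : Type*} [MetricSpace X] [CompactSpace X] [PseudoMetricSpace Y]
    {ι : Type*} (s : Finset ι) (g : ι → X → Y) (hg : ∀ i ∈ s, Continuous (g i)) {ε : ℝ}
    (hε : 0 < ε) :
    ∃ γ > 0, ∀ x y : X, dist x y < γ → ∀ i ∈ s, dist (g i x) (g i y) < ε := by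
  have h : ∀ i ∈ s, ∀ᶠ γ in 𝓝[>] (0 : ℝ), ∀ x y : X, dist x y < γ → dist (g i x) (g i y) < ε := by
    intro i hi
    obtain ⟨γ, hγ, h⟩ := Metric.uniformContinuous_iff.mp
      (CompactSpace.uniformContinuous_of_continuous (hg i hi)) ε hε
    filter_upwards [Ioo_mem_nhdsGT hγ] with γ' hγ' x y hxy
    exact h (hxy.trans hγ'.2)
  obtain ⟨γ, hγ, hpos⟩ := (((Filter.eventually_all_finset s).mpr h).and
    self_mem_nhdsWithin).exists
  exact ⟨γ, hpos, fun x y hxy i hi => hγ i hi x y hxy⟩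

/-- Uniform cw-expansiveness. -/
lemma CwExpansiveWith.uniform {X : Type*} [MetricSpace X] [CompactSpace X] {T : X ≃ₜ X} {δ : ℝ}
    (hT : CwExpansiveWith T δ) {η : ℝ} (hη : 0 < η) :
    ∃ N : ℕ, ∀ C : Set X, IsPreconnected C →
      (∀ j : ℤ, |j| ≤ N → ∀ x ∈ C, ∀ y ∈ C, dist ((T ^ j) x) ((T ^ j) y) ≤ δ) →
      ∀ x ∈ C, ∀ y ∈ C, dist x y < η := by
  by_contra! hcon
  choose C hC hCδ x hx y hy hxy using hcon
  let ω : Ultrafilter ℕ := Filter.hyperfilter ℕ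
  have hω : (ω : Filter ℕ) ≤ Filter.atTop := Nat.hyperfilter_le_atTop
  obtain ⟨a, ha, hxa⟩ := exists_mem_ultraLimit (ω := ω) (.of_forall hx)
  obtain ⟨b, hb, hyb⟩ := exists_mem_ultraLimit (ω := ω) (.of_forall hy)
  have hab : η ≤ dist a b := ge_of_tendsto (hxa.dist hyb) (.of_forall hxy)
  have := hT _ (isClosed_ultraLimit ω C) (isPreconnected_ultraLimit (.of_forall hC))
    (fun n u hu v hv => dist_le_of_mem_ultraLimit (T ^ n).continuous
      (hω ((Filter.eventually_ge_atTop n.natAbs).mono fun k hk => hCδ k n (by rw [Int.abs_eq_natAbs]; omega))) hu hv) ha hb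
  rw [this, dist_self] at hab
  linarith

/-- A continuum which is small at both ends of an orbit segment is `δ`-small all along it. -/
lemma CwExpansiveWith.exists_small_ends {X : Type*} [MetricSpace X] [CompactSpace X] {T : X ≃ₜ X}
    {δ : ℝ} (hδ : 0 < δ) (hT : CwExpansiveWith T δ) :
    ∃ ε > 0, ∀ n : ℕ, ∀ C : Set X, IsCompact C → IsPreconnected C →
      (∀ x ∈ C, ∀ y ∈ C, dist x y < ε) →
      (∀ x ∈ C, ∀ y ∈ C, dist ((T ^ (n : ℤ)) x) ((T ^ (n : ℤ)) y) < ε) →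
      ∀ j ∈ Finset.range (n + 1), ∀ x ∈ C, ∀ y ∈ C,
        dist ((T ^ (j : ℤ)) x) ((T ^ (j : ℤ)) y) ≤ δ := by
  by_contra! hcon
  have hstep : ∀ k : ℕ, ∃ (n j : ℕ) (D : Set X), IsPreconnected D ∧ j ≤ n ∧
      (∀ x ∈ D, ∀ y ∈ D, dist x y < 1 / ((k : ℝ) + 1)) ∧
      (∀ x ∈ D, ∀ y ∈ D, dist ((T ^ (n : ℤ)) x) ((T ^ (n : ℤ)) y) < 1 / ((k : ℝ) + 1)) ∧
      (∀ i ≤ n, ∀ x ∈ D, ∀ y ∈ D, dist ((T ^ (i : ℤ)) x) ((T ^ (i : ℤ)) y) ≤ δ) ∧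
      ∃ x ∈ D, ∃ y ∈ D, dist ((T ^ (j : ℤ)) x) ((T ^ (j : ℤ)) y) = δ / 2 := by
    intro k
    obtain ⟨n, C, hC, hconn, h0, hn, j, hj, x, hx, y, hy, hxy⟩ :=
      hcon (1 / ((k : ℝ) + 1)) (by positivity)
    have hne : (Finset.range (n + 1)).Nonempty := ⟨j, hj⟩
    let φ : X → ℝ := fun z => (Finset.range (n + 1)).sup' hne
      fun i => dist ((T ^ (i : ℤ)) x) ((T ^ (i : ℤ)) z)
    have hle : ∀ i ∈ Finset.range (n + 1), ∀ z,
        dist ((T ^ (i : ℤ)) x) ((T ^ (i : ℤ)) z) ≤ φ z := fun i hi z =>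
      Finset.le_sup' (fun i : ℕ => dist ((T ^ (i : ℤ)) x) ((T ^ (i : ℤ)) z)) hi
    have hφ : Continuous φ := Continuous.finset_sup'_apply hne fun i _ =>
      continuous_const.dist (T ^ (i : ℤ)).continuous
    obtain ⟨D, hDC, hD, hDconn, hxD, hDr, z, hz, hzr⟩ := exists_subcontinuum hC hconn hφ
      (r := δ / 2) hx (Finset.sup'_le _ _ fun i _ => by rw [dist_self]; linarith) hy
      (lt_of_lt_of_le (by linarith) (hle j hj y))
    obtain ⟨i, hi, hie⟩ := Finset.exists_mem_eq_sup' hne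
      fun i : ℕ => dist ((T ^ (i : ℤ)) x) ((T ^ (i : ℤ)) z)
    refine ⟨n, i, D, hDconn, Nat.lt_succ_iff.mp (Finset.mem_range.mp hi),
      fun a ha b hb => h0 a (hDC ha) b (hDC hb), fun a ha b hb => hn a (hDC ha) b (hDC hb),
      fun l hl a ha b hb => ?_, x, hxD, z, hz, hie.symm.trans hzr⟩
    have hl' : l ∈ Finset.range (n + 1) := Finset.mem_range.mpr (Nat.lt_succ_iff.mpr hl)
    have := dist_triangle_left ((T ^ (l : ℤ)) a) ((T ^ (l : ℤ)) b) ((T ^ (l : ℤ)) x)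
    linarith [(hle l hl' a).trans (hDr a ha), (hle l hl' b).trans (hDr b hb)]
  choose n j D hD hjn h0 hn hDδ x hx y hy hxy using hstep
  let ω : Ultrafilter ℕ := Filter.hyperfilter ℕ
  have hω : (ω : Filter ℕ) ≤ Filter.atTop := Nat.hyperfilter_le_atTop
  let C : ℕ → Set X := fun k => (T ^ (j k : ℤ)) '' D k
  have hfar : ∀ m : ℕ, ∀ᶠ k in (ω : Filter ℕ), m < j k ∧ m + j k < n k := by
    intro m
    obtain ⟨γ, hγ, hcont⟩ := exists_dist_iterate_lt (Finset.Icc (-(m : ℤ)) m)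
      (fun i => (T ^ i : X ≃ₜ X)) (fun i _ => (T ^ i).continuous) (half_pos hδ)
    have hev : ∀ᶠ k : ℕ in Filter.atTop, 1 / ((k : ℝ) + 1) < γ :=
      tendsto_one_div_add_atTop_nhds_zero_nat.eventually (gt_mem_nhds hγ)
    refine hω (hev.mono fun k hk => ⟨?_, ?_⟩) <;> by_contra! hle
    · exact absurd (hxy k) (hcont _ _ ((h0 k _ (hx k) _ (hy k)).trans hk) (j k)
        (by rw [Finset.mem_Icc]; omega)).ne
    · have := hcont _ _ ((hn k _ (hx k) _ (hy k)).trans hk) (j k - n k)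
        (by rw [Finset.mem_Icc]; have := hjn k; omega)
      simp only [← Homeomorph.zpow_add_apply, sub_add_cancel] at this
      exact absurd (hxy k) this.ne
  obtain ⟨a, ha, hxa⟩ := exists_mem_ultraLimit (ω := ω) (C := C)
    (.of_forall fun k => mem_image_of_mem _ (hx k))
  obtain ⟨b, hb, hyb⟩ := exists_mem_ultraLimit (ω := ω) (C := C)
    (.of_forall fun k => mem_image_of_mem _ (hy k))
  have hab : dist a b = δ / 2 := tendsto_nhds_unique (hxa.dist hyb)
    (by simp only [hxy]; exact tendsto_const_nhds)
  have := hT _ (isClosed_ultraLimit ω C)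
    (isPreconnected_ultraLimit (.of_forall fun k =>
      (hD k).image _ (T ^ (j k : ℤ)).continuous.continuousOn))
    (fun i u hu v hv => dist_le_of_mem_ultraLimit (T ^ i).continuous ?_ hu hv) ha hb
  · rw [this, dist_self] at hab
    linarith
  · filter_upwards [hfar i.natAbs] with k hk
    rintro _ ⟨p, hp, rfl⟩ _ ⟨q, hq, rfl⟩
    obtain ⟨l, hl⟩ : ∃ l : ℕ, (l : ℤ) = i + j k := ⟨(i + j k).toNat, by omega⟩
    simp only [← Homeomorph.zpow_add_apply, ← hl]
    exact hDδ k l (by omega) p hp q hq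

/-- The subcontinua of the set of points of a given period are trivial. -/
lemma CwExpansiveWith.subsingleton_of_isPeriodicPt {X : Type*} [MetricSpace X] [CompactSpace X]
    {T : X ≃ₜ X} {δ : ℝ} (hδ : 0 < δ) (hT : CwExpansiveWith T δ) {q : ℕ} (hq : 0 < q) {C : Set X}
    (hCq : ∀ x ∈ C, IsPeriodicPt T q x) (hC : IsClosed C) (hconn : IsPreconnected C) :
    C.Subsingleton := by
  intro x hx y hy
  by_contra hne
  obtain ⟨γ, hγ, hcont⟩ := exists_dist_iterate_lt (Finset.range q)
    (fun i => (T^[i] : X → X)) (fun i _ => T.continuous.iterate i) hδ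
  obtain ⟨r, hr, hrlt⟩ := exists_between (lt_min (dist_pos.mpr hne) (half_pos hγ))
  obtain ⟨D, hDC, hD, hDconn, hxD, hDr, z, hz, hzr⟩ := exists_subcontinuum hC.isCompact hconn
    (φ := fun z => dist x z) (by fun_prop) (r := r) hx (by simpa using hr.le) hy
    (hrlt.trans_le (min_le_left _ _))
  have hper : ∀ n : ℤ, ∃ i ∈ Finset.range q, ∀ u ∈ D, (T ^ n) u = T^[i] u := by
    intro n
    have hq' : (q : ℤ) ≠ 0 := by omega
    have hnn := Int.emod_nonneg n hq'
    have hlt := Int.emod_lt_of_pos n (show (0 : ℤ) < q by omega)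
    refine ⟨(n % q).toNat, Finset.mem_range.mpr (by omega), fun u hu => ?_⟩
    have hfix : (T ^ (q : ℤ)) u = u := by
      rw [T.zpow_natCast_apply]; exact hCq u (hDC hu)
    have hfix' : ∀ m : ℤ, (T ^ ((q : ℤ) * m)) u = u := by
      intro m
      rw [zpow_mul, ← Homeomorph.toEquiv_zpow_apply]
      exact Equiv.Perm.zpow_apply_eq_self_of_apply_eq_self hfix m
    rw [← T.zpow_natCast_apply, Int.toNat_of_nonneg hnn]
    conv_lhs => rw [← Int.emod_add_mul_ediv n q, T.zpow_add_apply, hfix']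
  have := hT D hD.isClosed hDconn (fun n u hu v hv => by
    obtain ⟨i, hi, h⟩ := hper n
    rw [h u hu, h v hv]
    refine (hcont u v ?_ i hi).le
    have := dist_triangle_left u v x
    linarith [hDr u hu, hDr v hv, min_le_right (dist x y) (γ / 2)]) hxD hz
  rw [← this, dist_self] at hzr
  linarith

/-- Finite-dimensionality of `X`: arbitrarily fine closed covers with a bounded number of colours,
such that cover elements of the same colour are disjoint. -/
lemma CwExpansiveWith.exists_coloured_cover {X : Type u} [MetricSpace X] [CompactSpace X]
    {T : X ≃ₜ X} {δ : ℝ} (hδ : 0 < δ) (hT : CwExpansiveWith T δ) :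
    ∃ (κ : Type u) (_ : Finite κ), ∀ η > 0, ∃ (ι : Type u) (_ : Finite ι) (E : ι → Set X)
      (col : ι → κ), (∀ i, IsClosed (E i)) ∧
      (∀ i j, i ≠ j → col i = col j → Disjoint (E i) (E j)) ∧ (⋃ i, E i) = univ ∧
      ∀ i, ∀ x ∈ E i, ∀ y ∈ E i, dist x y < η := by
  obtain ⟨ε, hε, hends⟩ := hT.exists_small_ends hδ
  obtain ⟨t, -, htfin, ht⟩ := finite_cover_balls_of_compact (isCompact_univ (X := X))
    (show 0 < ε / 3 by positivity)
  have : Finite t := htfin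
  refine ⟨t × t, inferInstance, fun η hη => ?_⟩
  obtain ⟨N, hN⟩ := hT.uniform (half_pos hη)
  let A : t × t → Set X := fun p =>
    {x | (T ^ (-N : ℤ)) x ∈ closedBall (p.1 : X) (ε / 3) ∧
      (T ^ (N : ℤ)) x ∈ closedBall (p.2 : X) (ε / 3)}
  have hA : ∀ p, IsClosed (A p) := fun p =>
    (isClosed_closedBall.preimage (T ^ (-N : ℤ)).continuous).inter
      (isClosed_closedBall.preimage (T ^ (N : ℤ)).continuous)
  have hball : ∀ c : X, ∀ u ∈ closedBall c (ε / 3), ∀ v ∈ closedBall c (ε / 3), dist u v < ε := by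
    intro c u hu v hv
    rw [mem_closedBall] at hu hv
    linarith [dist_triangle_right u v c]
  have hsmall : ∀ p, ∀ C ⊆ A p, IsClosed C → IsPreconnected C →
      ∀ x ∈ C, ∀ y ∈ C, dist x y < η / 2 := by
    intro p C hCA hC hconn
    refine hN C hconn fun j hj x hx y hy => ?_
    have := hends (2 * N) ((T ^ (-N : ℤ)) '' C) (hC.isCompact.image (T ^ (-N : ℤ)).continuous)
      (hconn.image _ (T ^ (-N : ℤ)).continuous.continuousOn) ?_ ?_ (j + N).toNat
      (by rw [Finset.mem_range]; grind) _ (mem_image_of_mem _ hx) _ (mem_image_of_mem _ hy)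
    · rw [← T.zpow_add_apply, ← T.zpow_add_apply,
        show ((j + N).toNat : ℤ) + -N = j by grind] at this
      exact this
    · rintro _ ⟨u, hu, rfl⟩ _ ⟨v, hv, rfl⟩
      exact hball _ _ (hCA hu).1 _ (hCA hv).1
    · rintro _ ⟨u, hu, rfl⟩ _ ⟨v, hv, rfl⟩
      rw [← T.zpow_add_apply, ← T.zpow_add_apply,
        show ((2 * N : ℕ) : ℤ) + -N = N by push_cast; ring]
      exact hball _ _ (hCA hu).2 _ (hCA hv).2
  choose ι hι E hE hdisj hU hd using fun p => exists_finite_partition (hA p) (hsmall p)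
  refine ⟨Σ p, ι p, inferInstance, fun s => E s.1 s.2, Sigma.fst, fun s => hE _ _, ?_, ?_,
    fun s x hx y hy => by simpa [mul_div_cancel₀] using hd s.1 s.2 x hx y hy⟩
  · rintro ⟨p, i⟩ ⟨p', i'⟩ hne rfl
    exact hdisj p i i' fun h => hne (by rw [h])
  · refine eq_univ_of_forall fun x => ?_
    obtain ⟨c, hc, hxc⟩ := mem_iUnion₂.mp (ht (mem_univ ((T ^ (-N : ℤ)) x)))
    obtain ⟨c', hc', hxc'⟩ := mem_iUnion₂.mp (ht (mem_univ ((T ^ (N : ℤ)) x)))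
    have hx : x ∈ A (⟨c, hc⟩, ⟨c', hc'⟩) := ⟨ball_subset_closedBall hxc,
      ball_subset_closedBall hxc'⟩
    rw [← hU] at hx
    obtain ⟨i, hi⟩ := mem_iUnion.mp hx
    exact mem_iUnion.mpr ⟨⟨_, i⟩, hi⟩

/-- Finite families of closed discrete cells such that every point is missed by boundedly many of
the families. -/
lemma CwExpansiveWith.exists_cells {X : Type u} [MetricSpace X] [CompactSpace X]
    {T : X ≃ₜ X} {δ : ℝ} (hδ : 0 < δ) (hT : CwExpansiveWith T δ) :
    ∃ K : ℕ, ∀ N : ℕ, ∀ η > 0, ∃ (σ : Type u) (_ : Finite σ) (C : ℕ → σ → Set X),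
      (∀ n s, IsClosed (C n s)) ∧ (∀ n s s', s ≠ s' → Disjoint (C n s) (C n s')) ∧
      (∀ n < N, ∀ s, ∀ x ∈ C n s, ∀ y ∈ C n s, dist x y < η) ∧
      ∀ x, {n | n < N ∧ ∀ s, x ∉ C n s}.ncard ≤ K := by
  obtain ⟨κ, hκ, hcover⟩ := hT.exists_coloured_cover hδ
  refine ⟨Nat.card κ, fun N η hη => ?_⟩
  obtain ⟨ι, hι, E, col, hE, hdisj, hU, hd⟩ := hcover (η / 2) (half_pos hη)
  obtain ⟨r, hrη, hr0, hr⟩ : ∃ r < η / 4, 0 < r ∧ ∀ i j, i ≠ j → col i = col j →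
      Disjoint (thickening r (E i)) (thickening r (E j)) := by
    have hev : ∀ᶠ r in 𝓝[>] (0 : ℝ), ∀ i j, i ≠ j → col i = col j →
        Disjoint (thickening r (E i)) (thickening r (E j)) := by
      refine Filter.eventually_all.mpr fun i => Filter.eventually_all.mpr fun j => ?_
      by_cases h : i ≠ j ∧ col i = col j
      · obtain ⟨r, hr, hrd⟩ := (hdisj i j h.1 h.2).exists_thickenings (hE i).isCompact (hE j)
        filter_upwards [Ioo_mem_nhdsGT hr] with r' hr' _ _
        exact hrd.mono (thickening_mono hr'.2.le _) (thickening_mono hr'.2.le _)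
      · exact .of_forall fun r h1 h2 => absurd ⟨h1, h2⟩ h
    obtain ⟨r, h, hr⟩ := (hev.and (Ioo_mem_nhdsGT (show (0 : ℝ) < η / 4 by positivity))).exists
    exact ⟨r, hr.2, hr.1, h⟩
  let a : ℕ → ℝ := fun n => r * (n / (N + 1))
  have ha_mono : Monotone a := fun m n hmn => by
    have : (m : ℝ) ≤ n := by exact_mod_cast hmn
    simp only [a]
    gcongr
  have ha_lt : ∀ n ≤ N, a n < r := fun n hn => by
    have : (n : ℝ) < N + 1 := by exact_mod_cast Nat.lt_succ_of_le hn
    exact mul_lt_of_lt_one_right hr0 ((div_lt_one (by positivity)).mpr this)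
  let C : ℕ → {S : Set ι // S.Nonempty} → Set X := fun n S => {x | ∀ i,
    (i ∈ S.1 → x ∈ cthickening (a n) (E i)) ∧ (i ∉ S.1 → x ∉ thickening (a (n + 1)) (E i))}
  refine ⟨{S : Set ι // S.Nonempty}, inferInstance, C,
    fun n S => ?_, fun n S S' hS => ?_, fun n hn S x hx y hy => ?_, fun x => ?_⟩
  · simp only [C, ofPred_forall]
    refine isClosed_iInter fun i => ?_
    by_cases hi : i ∈ S.1
    · simpa only [hi, true_imp_iff, not_true_eq_false, false_imp_iff, and_true] using!
        isClosed_cthickening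
    · simpa only [hi, false_imp_iff, true_and, not_false_eq_true, true_imp_iff] using!
        isOpen_thickening.isClosed_compl
  · have hsub : ∀ {S S' x}, x ∈ C n S → x ∈ C n S' → S.1 ⊆ S'.1 := by
      intro S S' x hx hx' i hi
      by_contra hi'
      refine (hx' i).2 hi' (cthickening_subset_thickening' ?_ ?_ _ ((hx i).1 hi))
      all_goals simp only [a]; push_cast
      · positivity
      · gcongr
        linarith
    rw [Set.disjoint_left]
    exact fun x hx hx' => hS (Subtype.ext ((hsub hx hx').antisymm (hsub hx' hx)))
  · obtain ⟨i, hi⟩ := S.2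
    have hsub := cthickening_subset_thickening' hr0 (ha_lt n hn.le) (E i)
    obtain ⟨x', hx', hxx⟩ := mem_thickening_iff.mp (hsub ((hx i).1 hi))
    obtain ⟨y', hy', hyy⟩ := mem_thickening_iff.mp (hsub ((hy i).1 hi))
    have := hd i x' hx' y' hy'
    have := dist_triangle4 x x' y' y
    rw [dist_comm y' y] at this
    linarith
  · obtain ⟨i, hi⟩ := mem_iUnion.mp (hU.symm ▸ mem_univ x : x ∈ ⋃ i, E i)
    have : Nonempty ι := ⟨i⟩
    have key : ∀ n ∈ {n | n < N ∧ ∀ S, x ∉ C n S},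
        ∃ j, x ∉ cthickening (a n) (E j) ∧ x ∈ thickening (a (n + 1)) (E j) := by
      rintro n ⟨-, hn⟩
      have := hn ⟨{i | x ∈ cthickening (a n) (E i)}, i, self_subset_cthickening _ hi⟩
      by_contra! hcon
      exact this fun j => ⟨fun h => h, fun h => hcon j h⟩
    choose! p hp hp' using key
    rw [← Set.ncard_univ κ]
    refine Set.ncard_le_ncard_of_injOn (fun n => col (p n)) (fun _ _ => mem_univ _) ?_
    have hpr : ∀ n, n < N → thickening (a (n + 1)) (E (p n)) ⊆ thickening r (E (p n)) :=
      fun n hn => thickening_mono (ha_lt _ hn).le _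
    have hlt : ∀ m ∈ {n | n < N ∧ ∀ S, x ∉ C n S},
        ∀ n ∈ {n | n < N ∧ ∀ S, x ∉ C n S}, col (p m) = col (p n) → ¬ m < n := by
      intro m hm n hn hcol hmn
      have hpp : p m = p n := by
        by_contra hne
        exact Set.disjoint_left.mp (hr _ _ hne hcol) (hpr m hm.1 (hp' m hm)) (hpr n hn.1 (hp' n hn))
      refine hp n hn (hpp ▸ thickening_subset_cthickening_of_le (ha_mono hmn) _ (hp' m hm))
    intro m hm n hn hcol
    exact le_antisymm (not_lt.mp (hlt n hn m hm hcol.symm)) (not_lt.mp (hlt m hm n hn hcol))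

lemma exists_injective_near {ι : Type*} [Finite ι] (w : ι → ℝ) {ε : ℝ} (hε : 0 < ε) :
    ∃ v : ι → ℝ, Injective v ∧ ∀ i, |v i - w i| < ε := by
  obtain ⟨m, ⟨e⟩⟩ := Finite.exists_equiv_fin ι
  have hfin : (⋃ p : ι × ι, {t : ℝ | p.1 ≠ p.2 ∧ w p.1 + t * (e p.1 : ℕ) = w p.2 + t * (e p.2 : ℕ)})
      |>.Finite := by
    refine Set.finite_iUnion fun p => Set.Subsingleton.finite ?_
    rintro s ⟨hne, hs⟩ t ⟨-, ht⟩
    have he : ((e p.1 : ℕ) : ℝ) - (e p.2 : ℕ) ≠ 0 := by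
      rw [sub_ne_zero]
      exact fun h => hne (e.injective (Fin.ext (by exact_mod_cast h)))
    exact mul_right_cancel₀ he (by linarith)
  obtain ⟨t, ht, htn⟩ := ((Ioo_infinite (show 0 < ε / (m + 1) by positivity)).sdiff hfin).nonempty
  refine ⟨fun i => w i + t * (e i : ℕ), fun i j hij => ?_, fun i => ?_⟩
  · by_contra hne
    exact htn (mem_iUnion.mpr ⟨(i, j), hne, hij⟩)
  · have h1 : ((e i : ℕ) : ℝ) < m + 1 := by exact_mod_cast (e i).2.trans (Nat.lt_succ_self m)
    rw [add_sub_cancel_left, abs_of_nonneg (mul_nonneg ht.1.le (Nat.cast_nonneg _))]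
    calc t * (e i : ℕ) ≤ t * (m + 1) := by gcongr; exact ht.1.le
      _ < ε := (lt_div_iff₀ (by positivity)).mp ht.2

/-- A continuous function can be perturbed so that it is constant on the members of a finite
disjoint family of closed sets on which it oscillates little, with distinct values. -/
lemma exists_flattening {X : Type*} [MetricSpace X] [CompactSpace X] {ι : Type*} [Finite ι]
    {E : ι → Set X} (hE : ∀ i, IsClosed (E i)) (hdisj : ∀ i j, i ≠ j → Disjoint (E i) (E j))
    (f : C(X, ℝ)) {ε : ℝ} (hε : 0 < ε) (hosc : ∀ i, ∀ x ∈ E i, ∀ y ∈ E i, dist (f x) (f y) < ε) :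
    ∃ (g : C(X, ℝ)) (v : ι → ℝ), Injective v ∧ (∀ i, ∀ x ∈ E i, g x = v i) ∧
      dist f g ≤ 2 * ε := by
  have hw : ∀ i, ∃ w : ℝ, ∀ x ∈ E i, dist (f x) w < ε := fun i => by
    rcases (E i).eq_empty_or_nonempty with h | ⟨x, hx⟩
    · exact ⟨0, by simp [h]⟩
    · exact ⟨f x, fun y hy => hosc i y hy x hx⟩
  choose w hw using hw
  obtain ⟨v, hv, hvw⟩ := exists_injective_near w hε
  have hcl : IsClosed (⋃ i, E i) := isClosed_iUnion_of_finite hE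
  have hex : ∀ x : ⋃ i, E i, ∃ i, (x : X) ∈ E i := fun x => mem_iUnion.mp x.2
  choose c hc using hex
  have hcu : ∀ (x : ⋃ i, E i) i, (x : X) ∈ E i → c x = i := fun x i hi => by
    by_contra hne
    exact Set.disjoint_left.mp (hdisj _ _ hne) (hc x) hi
  have hcc : Continuous fun x : ⋃ i, E i => v (c x) := by
    have : IsLocallyConstant c := by
      rw [IsLocallyConstant.iff_isOpen_fiber]
      intro i
      have hfib : c ⁻¹' {i} = (⋃ j : {j // j ≠ i}, Subtype.val ⁻¹' E j)ᶜ := by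
        ext x
        simp only [mem_preimage, mem_singleton_iff, mem_compl_iff, mem_iUnion, not_exists]
        refine ⟨fun h j hj => j.2 ((hcu x _ hj).symm.trans h), fun h => ?_⟩
        by_contra hne
        exact h ⟨c x, hne⟩ (hc x)
      have := isClosed_iUnion_of_finite (s := fun j : {j // j ≠ i} =>
        (Subtype.val ⁻¹' E j : Set (⋃ i, E i))) fun j => (hE j).preimage continuous_subtype_val
      exact hfib ▸ this.isOpen_compl
    exact (this.comp v).continuous
  have : CompactSpace (⋃ i, E i) := isCompact_iff_compactSpace.mp hcl.isCompact
  let h : C((⋃ i, E i : Set X), ℝ) :=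
    ⟨fun x => v (c x) - f x, hcc.sub (f.continuous.comp continuous_subtype_val)⟩
  obtain ⟨k, hk, hke⟩ := BoundedContinuousFunction.exists_norm_eq_domRestrict_eq_of_closed
    (BoundedContinuousFunction.mkOfCompact h) hcl
  have hnorm : ‖k‖ ≤ 2 * ε := by
    rw [hk, BoundedContinuousFunction.norm_le (by positivity)]
    intro x
    have h1 := hw _ _ (hc x)
    have h2 := hvw (c x)
    rw [Real.dist_eq] at h1
    have := abs_sub_le (v (c x)) (w (c x)) (f x)
    rw [abs_sub_comm (w (c x)) (f x)] at this
    change |v (c x) - f x| ≤ 2 * ε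
    linarith
  refine ⟨f + k.toContinuousMap, v, hv, fun i x hx => ?_, ?_⟩
  · have hx' : x ∈ ⋃ i, E i := mem_iUnion.mpr ⟨i, hx⟩
    have h1 : k x = v (c ⟨x, hx'⟩) - f x := congrArg (fun g => g ⟨x, hx'⟩) hke
    rw [hcu ⟨x, hx'⟩ i hx] at h1
    change f x + k x = v i
    rw [h1]; ring
  · rw [ContinuousMap.dist_le (by positivity)]
    intro x
    change dist (f x) (f x + k x) ≤ _
    rw [dist_self_add_right]
    exact (k.norm_coe_le_norm x).trans hnorm

/-- The perturbation lemma: `f` can be perturbed so that, up to boundedly many exceptional times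
for each point, it separates different times along the orbit of a set `Z` with disjoint iterates,
distant points of `Z`, the orbit of `Z` from a zero-dimensional set `P`, and distant points
of `P`. -/
lemma CwExpansiveWith.exists_perturbation {X : Type*} [MetricSpace X] [CompactSpace X]
    {T : X ≃ₜ X} {δ : ℝ} (hδ : 0 < δ) (hT : CwExpansiveWith T δ) :
    ∃ K : ℕ, ∀ (N : ℕ) (Z P : Set X), IsClosed Z → IsClosed P →
      (∀ C ⊆ P, IsClosed C → IsPreconnected C → C.Subsingleton) →
      (∀ m < N, ∀ n < N, m ≠ n → Disjoint (T^[m] '' Z) (T^[n] '' Z)) →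
      (∀ n < N, Disjoint (T^[n] '' Z) P) →
      ∀ (f : C(X, ℝ)), ∀ ε > 0, ∀ η > 0, ∃ (g : C(X, ℝ)) (G : ℕ → Set X), dist f g ≤ 2 * ε ∧
        (∀ z, {n | n < N ∧ z ∉ G n}.ncard ≤ K) ∧
        (∀ m < N, ∀ n < N, ∀ x ∈ Z ∩ G m, ∀ y ∈ Z ∩ G n, g (T^[m] x) = g (T^[n] y) →
          m = n ∧ dist x y < η) ∧
        (∀ n < N, ∀ x ∈ Z ∩ G n, ∀ p ∈ P, g (T^[n] x) ≠ g p) ∧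
        ∀ p ∈ P, ∀ p' ∈ P, g p = g p' → dist p p' < η := by
  obtain ⟨K, hK⟩ := hT.exists_cells hδ
  refine ⟨K, fun N Z P hZ hP hPtd hZd hZP f ε hε η hη => ?_⟩
  obtain ⟨γ, hγ, hcont⟩ := exists_dist_iterate_lt (Finset.range (N + 1))
    (fun i x => f (T^[i] x)) (fun i _ => f.continuous.comp (T.continuous.iterate i)) hε
  obtain ⟨η', hη', hη'm⟩ := exists_between (lt_min hγ hη)
  have hη'γ := hη'm.trans_le (min_le_left _ _)
  have hη'η := hη'm.trans_le (min_le_right _ _)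
  obtain ⟨σ, hσ, C, hC, hCd, hCη, hCK⟩ := hK N η' hη'
  obtain ⟨ι, hι, E, hE, hEd, hEU, hEη⟩ := exists_finite_partition (η := η' / 2) hP
    (fun C hCP hC hconn x hx y hy => by
      rw [hPtd C hCP hC hconn hx hy, dist_self]; positivity)
  have hEη' : ∀ i, ∀ x ∈ E i, ∀ y ∈ E i, dist x y < η' := fun i x hx y hy => by
    simpa [mul_div_cancel₀] using hEη i x hx y hy
  have hEP : ∀ i, E i ⊆ P := fun i => hEU ▸ subset_iUnion E i
  let A : (Fin N × σ) ⊕ ι → Set X :=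
    Sum.elim (fun p => T^[p.1] '' (Z ∩ C p.1 p.2)) E
  have hAZ : ∀ p : Fin N × σ, A (Sum.inl p) ⊆ T^[p.1] '' Z := fun p =>
    image_mono inter_subset_left
  have hA : ∀ a, IsClosed (A a) := by
    rintro (p | i)
    · exact ((hZ.inter (hC _ _)).isCompact.image (T.continuous.iterate _)).isClosed
    · exact hE i
  have hAd : ∀ a b, a ≠ b → Disjoint (A a) (A b) := by
    rintro (⟨m, s⟩ | i) (⟨n, s'⟩ | j) hne
    · by_cases hmn : m = n
      · subst hmn
        exact (disjoint_image_iff (T.injective.iterate m)).mpr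
          ((hCd m s s' fun h => hne (by rw [h])).mono inter_subset_right inter_subset_right)
      · exact (hZd m m.2 n n.2 (fun h => hmn (Fin.ext h))).mono (hAZ _) (hAZ _)
    · exact (hZP m m.2).mono (hAZ _) (hEP j)
    · exact ((hZP n n.2).mono (hAZ _) (hEP i)).symm
    · exact hEd i j fun h => hne (by rw [h])
  obtain ⟨g, v, hv, hgv, hfg⟩ := exists_flattening hA hAd f hε (by
    rintro (⟨m, s⟩ | i)
    · rintro _ ⟨x, hx, rfl⟩ _ ⟨y, hy, rfl⟩
      exact hcont x y ((hCη m m.2 s x hx.2 y hy.2).trans hη'γ) m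
        (Finset.mem_range.mpr (m.2.trans (Nat.lt_succ_self N)))
    · intro x hx y hy
      exact hcont x y ((hEη' i x hx y hy).trans hη'γ) 0 (by simp))
  have hgZ : ∀ (n : ℕ) (hn : n < N) (s : σ), ∀ x ∈ Z ∩ C n s,
      g (T^[n] x) = v (Sum.inl (⟨n, hn⟩, s)) := fun n hn s x hx =>
    hgv (Sum.inl (⟨n, hn⟩, s)) _ (mem_image_of_mem _ hx)
  have hgP : ∀ p ∈ P, ∃ i, p ∈ E i ∧ g p = v (Sum.inr i) := fun p hp => by
    rw [← hEU] at hp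
    obtain ⟨i, hi⟩ := mem_iUnion.mp hp
    exact ⟨i, hi, hgv (Sum.inr i) p hi⟩
  refine ⟨g, fun n => ⋃ s, C n s, hfg, fun z => ?_, ?_, ?_, ?_⟩
  · simpa only [mem_iUnion, not_exists] using hCK z
  · rintro m hm n hn x ⟨hxZ, hx⟩ y ⟨hyZ, hy⟩ he
    obtain ⟨s, hs⟩ := mem_iUnion.mp hx
    obtain ⟨s', hs'⟩ := mem_iUnion.mp hy
    rw [hgZ m hm s x ⟨hxZ, hs⟩, hgZ n hn s' y ⟨hyZ, hs'⟩] at he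
    have := hv he
    simp only [Sum.inl.injEq, Prod.mk.injEq, Fin.mk.injEq] at this
    obtain ⟨rfl, rfl⟩ := this
    exact ⟨rfl, (hCη m hm s x hs y hs').trans hη'η⟩
  · rintro n hn x ⟨hxZ, hx⟩ p hp he
    obtain ⟨s, hs⟩ := mem_iUnion.mp hx
    obtain ⟨i, -, hi⟩ := hgP p hp
    rw [hgZ n hn s x ⟨hxZ, hs⟩, hi] at he
    exact Sum.inl_ne_inr (hv he)
  · intro p hp p' hp' he
    obtain ⟨i, hpi, hi⟩ := hgP p hp
    obtain ⟨j, hpj, hj⟩ := hgP p' hp'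
    rw [hi, hj] at he
    obtain rfl := Sum.inr_injective (hv he)
    exact (hEη' i p hpi p' hpj).trans hη'η

/-- Generic continuous functions separate, along forward orbits, all pairs in `K`. -/
def GenericallySeparated {X : Type*} [MetricSpace X] [CompactSpace X] (T : X ≃ₜ X)
    (K : Set (X × X)) : Prop :=
  {f : C(X, ℝ) | ∀ p ∈ K, ∃ n : ℕ, f (T^[n] p.1) ≠ f (T^[n] p.2)} ∈ residual C(X, ℝ)

namespace GenericallySeparated

variable {X : Type*} [MetricSpace X] [CompactSpace X] {T : X ≃ₜ X} {K K' : Set (X × X)}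

lemma mono (h : GenericallySeparated T K) (hK : K' ⊆ K) : GenericallySeparated T K' :=
  Filter.mem_of_superset h fun _ hf p hp => hf p (hK hp)

lemma union (h : GenericallySeparated T K) (h' : GenericallySeparated T K') :
    GenericallySeparated T (K ∪ K') := by
  filter_upwards [h, h'] with f hf hf' p hp
  exact hp.elim (hf p) (hf' p)

lemma swap (h : GenericallySeparated T K) : GenericallySeparated T (Prod.swap ⁻¹' K) := by
  filter_upwards [h] with f hf p hp
  obtain ⟨n, hn⟩ := hf p.swap hp
  exact ⟨n, hn.symm⟩

lemma iUnion {S : ℕ → Set (X × X)} (h : ∀ k, GenericallySeparated T (S k)) :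
    GenericallySeparated T (⋃ k, S k) := by
  filter_upwards [countable_iInter_mem.mpr h] with f hf p hp
  obtain ⟨k, hk⟩ := mem_iUnion.mp hp
  exact mem_iInter.mp hf k p hk

lemma of_local {S : Set (X × X)}
    (h : ∀ p ∈ S, ∃ K ∈ 𝓝[S] p, GenericallySeparated T K) : GenericallySeparated T S := by
  choose! K hK hgen using h
  obtain ⟨t, htS, ht, hcov⟩ := TopologicalSpace.countable_cover_nhdsWithin hK
  filter_upwards [(countable_bInter_mem ht).mpr fun p hp => hgen p (htS hp)] with f hf p hp
  obtain ⟨q, hq, hpq⟩ := mem_iUnion₂.mp (hcov hp)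
  exact mem_iInter₂.mp hf q hq p hpq

lemma of_isCompact (hK : IsCompact K)
    (h : ∀ f : C(X, ℝ), ∀ ε > 0, ∃ g : C(X, ℝ), dist f g ≤ 2 * ε ∧
      ∀ p ∈ K, ∃ n : ℕ, g (T^[n] p.1) ≠ g (T^[n] p.2)) : GenericallySeparated T K := by
  refine residual_of_dense_open ?_ ?_
  · rw [isOpen_iff_mem_nhds]
    intro f hf
    refine hK.eventually_forall_of_forall_eventually fun p hp => ?_
    obtain ⟨n, hn⟩ := hf p hp
    have hc : Continuous (T^[n] : X → X) := T.continuous.iterate n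
    have hop : IsOpen {q : C(X, ℝ) × (X × X) | q.1 (T^[n] q.2.1) ≠ q.1 (T^[n] q.2.2)} :=
      isOpen_ne_fun (by fun_prop) (by fun_prop)
    exact Filter.mem_of_superset (hop.mem_nhds (x := (f, p)) hn) fun q hq => ⟨n, hq⟩
  · rw [Metric.dense_iff]
    intro f r hr
    obtain ⟨g, hg, hgK⟩ := h f (r / 3) (by positivity)
    exact ⟨g, by rw [mem_ball']; linarith, hgK⟩

end GenericallySeparated

/-- A finite set with disjoint iterates, missing a closed set `P`, has a closed neighbourhood with
the same properties. -/
lemma exists_closed_nhds {X : Type*} [MetricSpace X] [CompactSpace X] (T : X ≃ₜ X) {F P : Set X}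
    (hF : F.Finite) (hP : IsClosed P) (N : ℕ)
    (hd : ∀ m < N, ∀ n < N, m ≠ n → ∀ a ∈ F, ∀ b ∈ F, T^[m] a ≠ T^[n] b)
    (hFP : ∀ n < N, ∀ a ∈ F, T^[n] a ∉ P) :
    ∃ Z, IsClosed Z ∧ (∀ a ∈ F, Z ∈ 𝓝 a) ∧
      (∀ m < N, ∀ n < N, m ≠ n → Disjoint (T^[m] '' Z) (T^[n] '' Z)) ∧
      ∀ n < N, Disjoint (T^[n] '' Z) P := by
  have hc : ∀ n, Continuous (T^[n] : X → X) := fun n => T.continuous.iterate n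
  have hFc : ∀ n, IsCompact (T^[n] '' F) := fun n => (hF.image _).isCompact
  have h1 : ∀ m n : Fin N, m ≠ n → ∃ U, IsOpen U ∧ F ⊆ U ∧ Disjoint (T^[m] '' U) (T^[n] '' U) := by
    intro m n hmn
    have hdis : Disjoint (T^[m] '' F) (T^[n] '' F) := by
      rw [Set.disjoint_left]
      rintro _ ⟨a, ha, rfl⟩ ⟨b, hb, he⟩
      exact hd m m.2 n n.2 (fun h => hmn (Fin.ext h)) a ha b hb he.symm
    obtain ⟨O, O', hO, hO', hsub, hsub', hOO⟩ :=
      SeparatedNhds.of_isCompact_isCompact (hFc m) (hFc n) hdis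
    refine ⟨T^[m] ⁻¹' O ∩ T^[n] ⁻¹' O', (hO.preimage (hc m)).inter (hO'.preimage (hc n)),
      subset_inter (image_subset_iff.mp hsub) (image_subset_iff.mp hsub'), hOO.mono ?_ ?_⟩
    · exact image_subset_iff.mpr inter_subset_left
    · exact image_subset_iff.mpr inter_subset_right
  choose! U hU hFU hUd using h1
  let W : Set X := (⋂ (m : Fin N), ⋂ (n : Fin N), ⋂ (_ : m ≠ n), U m n) ∩
    ⋂ n : Fin N, T^[n] ⁻¹' Pᶜ
  have hW : IsOpen W := by
    refine IsOpen.inter ?_ ?_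
    · refine isOpen_iInter_of_finite fun m => isOpen_iInter_of_finite fun n =>
        isOpen_iInter_of_finite fun h => hU m n h
    · exact isOpen_iInter_of_finite fun n => hP.isOpen_compl.preimage (hc n)
  have hFW : F ⊆ W := fun a ha =>
    ⟨mem_iInter.mpr fun m => mem_iInter.mpr fun n => mem_iInter.mpr fun h => hFU m n h ha,
      mem_iInter.mpr fun n => hFP n n.2 a ha⟩
  obtain ⟨r, hr, hrW⟩ := hF.isCompact.exists_cthickening_subset_open hW hFW
  refine ⟨cthickening r F, isClosed_cthickening, fun a ha => ?_, fun m hm n hn hmn => ?_,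
    fun n hn => ?_⟩
  · exact Filter.mem_of_superset (isOpen_thickening.mem_nhds (self_subset_thickening hr F ha))
      (thickening_subset_cthickening r F)
  · have hsub : cthickening r F ⊆ U ⟨m, hm⟩ ⟨n, hn⟩ := fun x hx =>
      mem_iInter.mp (mem_iInter.mp (mem_iInter.mp (hrW hx).1 ⟨m, hm⟩) ⟨n, hn⟩)
        (fun h => hmn (Fin.mk.inj h))
    exact (hUd ⟨m, hm⟩ ⟨n, hn⟩ (fun h => hmn (Fin.mk.inj h))).mono (image_mono hsub)
      (image_mono hsub)
  · rw [Set.disjoint_left]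
    rintro _ ⟨x, hx, rfl⟩
    exact mem_iInter.mp (hrW hx).2 ⟨n, hn⟩

lemma Function.Injective.eq_iterate_sub {X : Type*} {T : X → X} (hT : Injective T) {m n : ℕ}
    (hmn : m ≤ n) {a b : X} (h : T^[m] a = T^[n] b) : a = T^[n - m] b := by
  refine hT.iterate m ?_
  rw [h, ← iterate_add_apply, Nat.add_sub_cancel' hmn]

lemma Function.Injective.iterate_ne_of_notMem_periodicPts {X : Type*} {T : X → X}
    (hT : Injective T) {x : X} (hx : x ∉ periodicPts T) {m n : ℕ} (hmn : m ≠ n) :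
    T^[m] x ≠ T^[n] x := by
  intro h
  rcases lt_or_gt_of_ne hmn with hlt | hlt
  · exact hx ⟨n - m, Nat.sub_pos_of_lt hlt, (hT.eq_iterate_sub hlt.le h).symm⟩
  · exact hx ⟨m - n, Nat.sub_pos_of_lt hlt, (hT.eq_iterate_sub hlt.le h.symm).symm⟩

lemma isClosed_setOf_isPeriodicPt {X : Type*} [TopologicalSpace X] [T2Space X] {T : X → X}
    (hT : Continuous T) (q : ℕ) : IsClosed {x | IsPeriodicPt T q x} :=
  isClosed_eq (hT.iterate q) continuous_id

/-- Two exceptional sets of at most `K` times leave out some time. -/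
lemma exists_lt_notMem_of_ncard_le {A B : Set ℕ} {K M : ℕ} (hM : 2 * K < M) (hA : A.Finite)
    (hB : B.Finite) (hAK : A.ncard ≤ K) (hBK : B.ncard ≤ K) : ∃ n < M, n ∉ A ∧ n ∉ B := by
  by_contra! hcon
  have hsub : Set.Iio M ⊆ A ∪ B := fun n hn => by
    by_cases h : n ∈ A
    · exact Or.inl h
    · exact Or.inr (hcon n hn h)
  have h1 := Set.ncard_le_ncard hsub (hA.union hB)
  have h2 := Set.ncard_union_le A B
  have h3 : (Set.Iio M).ncard = M := by rw [← Finset.coe_Iio, Set.ncard_coe_finset, Nat.card_Iio]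
  omega

namespace CwExpansiveWith

variable {X : Type*} [MetricSpace X] [CompactSpace X] {T : X ≃ₜ X} {δ : ℝ}

lemma separated_isPeriodicPt (hδ : 0 < δ) (hT : CwExpansiveWith T δ) {q : ℕ} (hq : 0 < q) :
    GenericallySeparated T
      {p | IsPeriodicPt T q p.1 ∧ IsPeriodicPt T q p.2 ∧ p.1 ≠ p.2} := by
  obtain ⟨K, hK⟩ := hT.exists_perturbation hδ
  have hP := isClosed_setOf_isPeriodicPt T.continuous q
  refine .of_local fun p hp => ?_
  have hpos : 0 < dist p.1 p.2 := dist_pos.mpr hp.2.2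
  refine ⟨{u | IsPeriodicPt T q u.1 ∧ IsPeriodicPt T q u.2 ∧ dist p.1 p.2 / 2 ≤ dist u.1 u.2},
    ?_, .of_isCompact ?_ ?_⟩
  · have hop : IsOpen {u : X × X | dist p.1 p.2 / 2 < dist u.1 u.2} :=
      isOpen_lt continuous_const continuous_dist
    filter_upwards [self_mem_nhdsWithin, mem_nhdsWithin_of_mem_nhds
      (hop.mem_nhds (x := p) (half_lt_self hpos))] with u hu hu'
    exact ⟨hu.1, hu.2.1, le_of_lt hu'⟩
  · exact ((hP.preimage continuous_fst).inter ((hP.preimage continuous_snd).inter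
      (isClosed_le continuous_const continuous_dist))).isCompact
  · intro f ε hε
    obtain ⟨g, G, hfg, -, -, -, hg⟩ := hK 0 ∅ _ isClosed_empty hP
      (fun C hCP hC hconn => hT.subsingleton_of_isPeriodicPt hδ hq hCP hC hconn)
      (by simp) (by simp) f ε hε (dist p.1 p.2 / 2) (half_pos hpos)
    exact ⟨g, hfg, fun u hu => ⟨0, fun he => absurd (hg _ hu.1 _ hu.2.1 he) (not_lt.mpr hu.2.2)⟩⟩

lemma separated_notMem_periodicPts_isPeriodicPt (hδ : 0 < δ) (hT : CwExpansiveWith T δ) {q : ℕ}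
    (hq : 0 < q) :
    GenericallySeparated T {p | p.1 ∉ periodicPts T ∧ IsPeriodicPt T q p.2} := by
  obtain ⟨K, hK⟩ := hT.exists_perturbation hδ
  have hP := isClosed_setOf_isPeriodicPt T.continuous q
  refine .of_local fun p hp => ?_
  obtain ⟨Z, hZ, hZp, hZd, hZP⟩ := exists_closed_nhds T (finite_singleton p.1) hP (2 * K + 1)
    (fun m _ n _ hmn a ha b hb => by
      rw [mem_singleton_iff.mp ha, mem_singleton_iff.mp hb]
      exact T.injective.iterate_ne_of_notMem_periodicPts hp.1 hmn)
    (fun n _ a ha h => hp.1 ⟨q, hq, by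
      rw [mem_singleton_iff.mp ha] at h
      have h' : T^[q] (T^[n] p.1) = T^[n] p.1 := h
      rw [← iterate_add_apply, add_comm, iterate_add_apply] at h'
      exact T.injective.iterate n h'⟩)
  refine ⟨Z ×ˢ {x | IsPeriodicPt T q x}, ?_, .of_isCompact (hZ.prod hP).isCompact ?_⟩
  · filter_upwards [self_mem_nhdsWithin, mem_nhdsWithin_of_mem_nhds
      (continuous_fst.continuousAt.preimage_mem_nhds (hZp p.1 rfl))] with u hu hu'
    exact ⟨hu', hu.2⟩
  · intro f ε hε
    obtain ⟨g, G, hfg, hGK, -, hg, -⟩ := hK (2 * K + 1) Z _ hZ hP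
      (fun C hCP hC hconn => hT.subsingleton_of_isPeriodicPt hδ hq hCP hC hconn)
      hZd hZP f ε hε 1 one_pos
    refine ⟨g, hfg, fun u hu => ?_⟩
    have hfin : {n | n < 2 * K + 1 ∧ u.1 ∉ G n}.Finite := (finite_Iio _).subset fun n hn => hn.1
    obtain ⟨n, hn, hnG, -⟩ := exists_lt_notMem_of_ncard_le (Nat.lt_succ_self _) hfin hfin
      (hGK u.1) (hGK u.1)
    have hper : IsPeriodicPt T q (T^[n] u.2) := IsPeriodicPt.apply_iterate hu.2 n
    exact ⟨n, hg n hn u.1 ⟨hu.1, by by_contra h; exact hnG ⟨hn, h⟩⟩ _ hper⟩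

lemma separated_nhds_iterate (hδ : 0 < δ) (hT : CwExpansiveWith T δ) {x : X}
    (hx : x ∉ periodicPts T) {q : ℕ} (hq : 0 < q) :
    ∃ K ∈ 𝓝 (x, T^[q] x), GenericallySeparated T K := by
  obtain ⟨K, hK⟩ := hT.exists_perturbation hδ
  obtain ⟨Z, hZ, hZx, hZd, -⟩ := exists_closed_nhds T (finite_singleton x) isClosed_empty
    (2 * K + 1 + q)
    (fun m _ n _ hmn a ha b hb => by
      rw [mem_singleton_iff.mp ha, mem_singleton_iff.mp hb]
      exact T.injective.iterate_ne_of_notMem_periodicPts hx hmn) (by simp)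
  have hopen : IsOpenMap (T^[q] : X → X) :=
    q.recOn IsOpenMap.id fun n ih => iterate_succ T n ▸ ih.comp T.isOpenMap
  refine ⟨Z ×ˢ (T^[q] '' Z), prod_mem_nhds (hZx x rfl) (hopen.image_mem_nhds (hZx x rfl)),
    .of_isCompact (hZ.isCompact.prod (hZ.isCompact.image (T.continuous.iterate q))) ?_⟩
  intro f ε hε
  obtain ⟨g, G, hfg, hGK, hg, -, -⟩ := hK (2 * K + 1 + q) Z ∅ hZ isClosed_empty
    (fun C hC _ _ => by rw [subset_empty_iff.mp hC]; exact subsingleton_empty)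
    hZd (by simp) f ε hε 1 one_pos
  refine ⟨g, hfg, ?_⟩
  rintro ⟨u, _⟩ ⟨hu, w, hw, rfl⟩
  have hfin : ∀ z, {n | n < 2 * K + 1 + q ∧ z ∉ G n}.Finite := fun z =>
    (finite_Iio _).subset fun n hn => hn.1
  have hinj : Injective fun n => n + q := add_left_injective q
  obtain ⟨n, hn, hnu, hnw⟩ := exists_lt_notMem_of_ncard_le (Nat.lt_succ_self (2 * K)) (hfin u)
    ((hfin w).preimage hinj.injOn) (hGK u)
    (B := (fun n => n + q) ⁻¹' {n | n < 2 * K + 1 + q ∧ w ∉ G n})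
    (((Set.ncard_image_of_injective _ hinj).symm.trans_le
      (Set.ncard_le_ncard (image_preimage_subset _ _) (hfin w))).trans (hGK w))
  refine ⟨n, fun he => ?_⟩
  have hn1 : n < 2 * K + 1 + q := by omega
  have hn2 : n + q < 2 * K + 1 + q := by omega
  have := (hg n hn1 (n + q) hn2 u ⟨hu, by by_contra h; exact hnu ⟨hn1, h⟩⟩
    w ⟨hw, by by_contra h; exact hnw ⟨hn2, h⟩⟩ (by rw [iterate_add_apply]; exact he)).1
  omega

lemma separated_notMem_periodicPts (hδ : 0 < δ) (hT : CwExpansiveWith T δ) :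
    GenericallySeparated T
      {p | p.1 ∉ periodicPts T ∧ p.2 ∉ periodicPts T ∧ p.1 ≠ p.2} := by
  refine .of_local ?_
  rintro ⟨x, y⟩ ⟨hx, hy, hxy⟩
  by_cases hxy' : ∃ q > 0, y = T^[q] x
  · obtain ⟨q, hq, rfl⟩ := hxy'
    obtain ⟨K, hK, hgen⟩ := hT.separated_nhds_iterate hδ hx hq
    exact ⟨K, mem_nhdsWithin_of_mem_nhds hK, hgen⟩
  by_cases hyx : ∃ q > 0, x = T^[q] y
  · obtain ⟨q, hq, rfl⟩ := hyx
    obtain ⟨K, hK, hgen⟩ := hT.separated_nhds_iterate hδ hy hq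
    exact ⟨_, mem_nhdsWithin_of_mem_nhds
      (continuous_swap.continuousAt.preimage_mem_nhds hK), hgen.swap⟩
  obtain ⟨K, hK⟩ := hT.exists_perturbation hδ
  have horb : ∀ {a b : X}, a ≠ b → (¬ ∃ q > 0, b = T^[q] a) → (¬ ∃ q > 0, a = T^[q] b) →
      ∀ m n : ℕ, T^[m] a ≠ T^[n] b := by
    intro a b hab h1 h2 m n he
    rcases lt_trichotomy m n with hlt | rfl | hlt
    · exact h2 ⟨n - m, Nat.sub_pos_of_lt hlt, T.injective.eq_iterate_sub hlt.le he⟩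
    · exact hab (T.injective.iterate m he)
    · exact h1 ⟨m - n, Nat.sub_pos_of_lt hlt, T.injective.eq_iterate_sub hlt.le he.symm⟩
  obtain ⟨Z, hZ, hZx, hZd, -⟩ := exists_closed_nhds T (toFinite {x, y}) isClosed_empty
    (2 * K + 1)
    (fun m _ n _ hmn a ha b hb => by
      rcases ha with rfl | rfl <;> rcases hb with rfl | rfl
      · exact T.injective.iterate_ne_of_notMem_periodicPts hx hmn
      · exact horb hxy hxy' hyx m n
      · exact horb (Ne.symm hxy) hyx hxy' m n
      · exact T.injective.iterate_ne_of_notMem_periodicPts hy hmn) (by simp)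
  have hpos : 0 < dist x y := dist_pos.mpr hxy
  refine ⟨Z ×ˢ Z ∩ {u | dist x y / 2 ≤ dist u.1 u.2}, mem_nhdsWithin_of_mem_nhds
    (Filter.inter_mem (prod_mem_nhds (hZx x (by simp)) (hZx y (by simp))) ?_),
    .of_isCompact ((hZ.prod hZ).inter (isClosed_le continuous_const continuous_dist)).isCompact ?_⟩
  · exact Filter.mem_of_superset ((isOpen_lt continuous_const continuous_dist).mem_nhds
      (x := (x, y)) (show dist x y / 2 < dist x y from half_lt_self hpos))
      fun u (hu : dist x y / 2 < dist u.1 u.2) => hu.le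
  · intro f ε hε
    obtain ⟨g, G, hfg, hGK, hg, -, -⟩ := hK (2 * K + 1) Z ∅ hZ isClosed_empty
      (fun C hC _ _ => by rw [subset_empty_iff.mp hC]; exact subsingleton_empty)
      hZd (by simp) f ε hε (dist x y / 2) (half_pos hpos)
    refine ⟨g, hfg, fun u hu => ?_⟩
    have hfin : ∀ z, {n | n < 2 * K + 1 ∧ z ∉ G n}.Finite := fun z =>
      (finite_Iio _).subset fun n hn => hn.1
    obtain ⟨n, hn, hn1, hn2⟩ := exists_lt_notMem_of_ncard_le (Nat.lt_succ_self _) (hfin u.1)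
      (hfin u.2) (hGK u.1) (hGK u.2)
    refine ⟨n, fun he => absurd (hg n hn n hn u.1 ⟨hu.1.1, by by_contra h; exact hn1 ⟨hn, h⟩⟩
      u.2 ⟨hu.1.2, by by_contra h; exact hn2 ⟨hn, h⟩⟩ he).2 (not_lt.mpr hu.2)⟩

lemma separated_offDiag (hδ : 0 < δ) (hT : CwExpansiveWith T δ) :
    GenericallySeparated T {p | p.1 ≠ p.2} := by
  have h1 := GenericallySeparated.iUnion fun k : ℕ => hT.separated_isPeriodicPt hδ k.succ_pos
  have h2 := GenericallySeparated.iUnion fun k : ℕ =>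
    hT.separated_notMem_periodicPts_isPeriodicPt hδ k.succ_pos
  refine ((h1.union h2).union (h2.swap.union (hT.separated_notMem_periodicPts hδ))).mono ?_
  rintro ⟨x, y⟩ hxy
  have hsucc : ∀ {q : ℕ}, 0 < q → (q - 1).succ = q := fun hq => by omega
  by_cases hx : x ∈ periodicPts T <;> by_cases hy : y ∈ periodicPts T
  · obtain ⟨q, hq, hqx⟩ := hx
    obtain ⟨q', hq', hqy⟩ := hy
    refine Or.inl (Or.inl (mem_iUnion.mpr ⟨q * q' - 1, ?_⟩))
    rw [hsucc (Nat.mul_pos hq hq')]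
    exact ⟨hqx.mul_const q', hqy.const_mul q, hxy⟩
  · obtain ⟨q, hq, hqx⟩ := hx
    refine Or.inr (Or.inl (mem_iUnion.mpr ⟨q - 1, ?_⟩))
    rw [hsucc hq]
    exact ⟨hy, hqx⟩
  · obtain ⟨q, hq, hqy⟩ := hy
    refine Or.inl (Or.inr (mem_iUnion.mpr ⟨q - 1, ?_⟩))
    rw [hsucc hq]
    exact ⟨hx, hqy⟩
  · exact Or.inr (Or.inr ⟨hx, hy, hxy⟩)

end CwExpansiveWith

lemma obsNum_eq_one_of_exists {X : Type*} [TopologicalSpace X] {T : X → X}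
    (h : ∃ f : C(X, ℝ), ∀ x y : X, x ≠ y → ∃ n : ℕ, f (T^[n] x) ≠ f (T^[n] y)) :
    obsNum T = 1 := by
  obtain ⟨f, hf⟩ := h
  refine le_antisymm (sInf_le ⟨1, rfl, le_rfl,
    ⟨fun x => WithLp.toLp 2 fun _ => f x, by fun_prop⟩, fun x y hxy => ?_⟩) (le_sInf ?_)
  · obtain ⟨n, hn⟩ := hf x y hxy
    exact ⟨n, fun he => hn (congrArg (fun v : EuclideanSpace ℝ (Fin 1) => v 0) he)⟩
  · rintro _ ⟨k, rfl, hk, -⟩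
    exact_mod_cast hk

/-- If `T` is a cw-expansive homeomorphism of a compact metric space `X`, then a residual
set of `f ∈ C(X, ℝ)` observes `T`; in particular `Obs(T) = 1`. -/
theorem stmt6 {X : Type*} [MetricSpace X] [CompactSpace X]
    (T : X ≃ₜ X)
    (hcw : ∃ δ : ℝ, 0 < δ ∧ ∀ C : Set X, IsCompact C → IsConnected C → C.Nontrivial →
      ∃ n : ℤ, δ < diam ((T.toEquiv ^ n) '' C)) :
    {f : C(X, ℝ) | ∀ x y : X, x ≠ y → ∃ n : ℕ, f ((⇑T)^[n] x) ≠ f ((⇑T)^[n] y)} ∈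
        residual C(X, ℝ) ∧
      obsNum (⇑T) = 1 := by
  obtain ⟨δ, hδ, h⟩ := hcw
  have hres : {f : C(X, ℝ) | ∀ x y : X, x ≠ y → ∃ n : ℕ, f ((⇑T)^[n] x) ≠ f ((⇑T)^[n] y)} ∈
      residual C(X, ℝ) :=
    Filter.mem_of_superset ((cwExpansiveWith_of_diam hδ h).separated_offDiag hδ)
      fun f hf x y hxy => hf (x, y) hxy
  exact ⟨hres, obsNum_eq_one_of_exists (dense_of_mem_residual hres).nonempty⟩
end

section
/- Let A ∈ M_d(ℤ) be an invertible matrix with |det A| > 1 and no eigenvalue of modulus one, and let T : 𝕋^d → 𝕋^d be the induced non-invertible hyperbolic toral endomorphism on 𝕋^d = ℝ^d/ℤ^d. Then Obs(T) = 2: there exists a continuous f : 𝕋^d → ℝ^2 observing T, but no continuous f : 𝕋^d → ℝ observes T. -/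
open Set Topology Function

/-- The endomorphism of the torus `𝕋^d = ℝ^d/ℤ^d` (realized as `Fin d → ℝ/ℤ`) induced by an
integer matrix `A`, i.e. `T(x + ℤ^d) = Ax + ℤ^d`. -/
noncomputable def toralEndo (d : ℕ) (A : Matrix (Fin d) (Fin d) ℤ) :
    (Fin d → UnitAddCircle) → (Fin d → UnitAddCircle) :=
  fun x i => ∑ j, A i j • x j

section

open Polynomial

/-- A bounded solution of `a (n + 1) = z a n` up to an exponentially small error decays
exponentially when `z` lies off an annulus containing the unit circle. -/
lemma decay_step {lam C B : ℝ} {z : ℂ} (hlam : 0 < lam) (hlam1 : lam < 1) (hz : ‖z‖ < lam ∨ 1 < ‖z‖)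
    {a : ℕ → ℂ} (hB : ∀ n, ‖a n‖ ≤ B) (hC : ∀ n, ‖a (n + 1) - z * a n‖ ≤ C * lam ^ n) :
    ∃ C', ∀ n, ‖a n‖ ≤ C' * lam ^ n := by
  rcases hz with hz | hz
  · have hpos : 0 < lam - ‖z‖ := by linarith
    refine ⟨max ‖a 0‖ (C / (lam - ‖z‖)), fun n => ?_⟩
    induction n with
    | zero => simp
    | succ n ih =>
      set K := max ‖a 0‖ (C / (lam - ‖z‖)) with hK
      have h1 : C ≤ K * (lam - ‖z‖) := by
        rw [← div_le_iff₀ hpos]; exact le_max_right _ _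
      have h2 : ‖a (n + 1)‖ ≤ ‖a (n + 1) - z * a n‖ + ‖z‖ * ‖a n‖ := by
        rw [← norm_mul]; simpa using norm_add_le (a (n + 1) - z * a n) (z * a n)
      have h3 : ‖z‖ * ‖a n‖ ≤ ‖z‖ * (K * lam ^ n) := by gcongr
      have h4 : C * lam ^ n ≤ K * (lam - ‖z‖) * lam ^ n := by gcongr
      have h5 := hC n
      rw [pow_succ]
      linarith
  · have hpos : 0 < ‖z‖ - lam := by linarith
    have hz0 : 0 < ‖z‖ := by linarith
    have key : ∀ m n, ‖a n‖ ≤ C / (‖z‖ - lam) * lam ^ n + B * (‖z‖⁻¹) ^ m := by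
      intro m
      induction m with
      | zero =>
        intro n
        have hC0 : 0 ≤ C := by simpa using (norm_nonneg _).trans (hC 0)
        have : 0 ≤ C / (‖z‖ - lam) * lam ^ n := by positivity
        have := hB n
        simp only [pow_zero, mul_one]
        linarith
      | succ m ih =>
        intro n
        have h2 : ‖z‖ * ‖a n‖ ≤ ‖a (n + 1)‖ + ‖a (n + 1) - z * a n‖ := by
          rw [← norm_mul]
          simpa using norm_sub_le (a (n + 1)) (a (n + 1) - z * a n)
        have h3 := ih (n + 1)
        have h4 := hC n
        have h5 : ‖z‖ * (C / (‖z‖ - lam) * lam ^ n + B * (‖z‖⁻¹) ^ (m + 1)) =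
            C / (‖z‖ - lam) * lam ^ (n + 1) + B * (‖z‖⁻¹) ^ m + C * lam ^ n := by
          have hK : C / (‖z‖ - lam) * (‖z‖ - lam) = C := div_mul_cancel₀ _ hpos.ne'
          have hinv : ‖z‖ * ‖z‖⁻¹ = 1 := mul_inv_cancel₀ hz0.ne'
          linear_combination lam ^ n * hK + B * ‖z‖⁻¹ ^ m * hinv
        refine le_of_mul_le_mul_left ?_ hz0
        rw [h5]
        linarith
    refine ⟨C / (‖z‖ - lam), fun n => ?_⟩
    have ht : Filter.Tendsto (fun m : ℕ => C / (‖z‖ - lam) * lam ^ n + B * (‖z‖⁻¹) ^ m)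
        Filter.atTop (𝓝 (C / (‖z‖ - lam) * lam ^ n + B * 0)) :=
      ((tendsto_pow_atTop_nhds_zero_of_lt_one (by positivity) (inv_lt_one_of_one_lt₀ hz)).const_mul
        B).const_add _
    rw [mul_zero, add_zero] at ht
    exact ge_of_tendsto' ht fun m => key m n

/-- The left shift on complex sequences. -/
def seqShift : (ℕ → ℂ) →ₗ[ℂ] (ℕ → ℂ) := LinearMap.funLeft ℂ ℂ Nat.succ

lemma seqShift_pow_apply (k : ℕ) (a : ℕ → ℂ) (n : ℕ) : (seqShift ^ k) a n = a (n + k) := by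
  induction k generalizing n with
  | zero => simp
  | succ k ih =>
    rw [pow_succ', Module.End.mul_apply]
    change (seqShift ^ k) a (n + 1) = _
    rw [ih]; congr 1; ring

lemma decay_of_prod {lam : ℝ} (hlam : 0 < lam) (hlam1 : lam < 1) (s : Multiset ℂ)
    (hs : ∀ z ∈ s, ‖z‖ < lam ∨ 1 < ‖z‖) {a : ℕ → ℂ} {B C : ℝ} (hB : ∀ n, ‖a n‖ ≤ B)
    (hC : ∀ n, ‖aeval seqShift (s.map fun z => X - Polynomial.C z).prod a n‖ ≤ C * lam ^ n) :
    ∃ C', ∀ n, ‖a n‖ ≤ C' * lam ^ n := by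
  induction s using Multiset.induction_on generalizing a B C with
  | empty => exact ⟨C, by simpa using hC⟩
  | cons z s ih =>
    have hval : ∀ n, aeval seqShift (X - Polynomial.C z) a n = a (n + 1) - z * a n := by
      intro n
      simp [seqShift, LinearMap.funLeft_apply, Module.algebraMap_end_apply]
    have hbd : ∀ n, ‖aeval seqShift (X - Polynomial.C z) a n‖ ≤ B + ‖z‖ * B := by
      intro n
      rw [hval]
      refine (norm_sub_le _ _).trans ?_
      rw [norm_mul]
      gcongr <;> apply hB
    obtain ⟨C', hC'⟩ := ih (fun w hw => hs w (Multiset.mem_cons_of_mem hw)) hbd (C := C) (by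
      intro n
      have := hC n
      rwa [Multiset.map_cons, Multiset.prod_cons, mul_comm, map_mul, Module.End.mul_apply] at this)
    exact decay_step hlam hlam1 (hs z (Multiset.mem_cons_self _ _)) hB
      (fun n => by rw [← hval]; exact hC' n)

lemma decay_of_recurrence {lam : ℝ} (hlam : 0 < lam) (hlam1 : lam < 1) {p : ℤ[X]} (hp : p.Monic)
    (hroots : ∀ z ∈ (p.map (Int.castRingHom ℂ)).roots, ‖z‖ < lam ∨ 1 < ‖z‖)
    {a : ℕ → ℝ} {B : ℝ} (hB : ∀ n, |a n| ≤ B)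
    (hrec : ∀ n, ∑ k ∈ Finset.range (p.natDegree + 1), (p.coeff k : ℝ) * a (n + k) = 0) :
    ∃ C, ∀ n, |a n| ≤ C * lam ^ n := by
  have hfac := (IsAlgClosed.splits (p.map (Int.castRingHom ℂ))).eq_prod_roots_of_monic
    (hp.map _)
  have := decay_of_prod hlam hlam1 _ hroots (a := fun n => (a n : ℂ)) (B := B) (C := 0)
    (by simpa using hB) (by
      intro n
      rw [← hfac, aeval_eq_sum_range, hp.natDegree_map]
      simp only [LinearMap.sum_apply, LinearMap.smul_apply, Finset.sum_apply, Pi.smul_apply,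
        seqShift_pow_apply, coeff_map, smul_eq_mul]
      have h := congrArg (fun x : ℝ => (x : ℂ)) (hrec n)
      push_cast at h
      rw [zero_mul, norm_le_zero_iff]
      simpa using h)
  simpa using this

lemma abs_sub_round_eq_abs {t : ℝ} (ht : |t| ≤ 1 / 2) : |t - round t| = |t| := by
  refine le_antisymm (by simpa using round_le t 0) ?_
  rcases eq_or_ne (round t) 0 with h | h
  · simp [h]
  · have h1 : (1 : ℝ) ≤ |(round t : ℝ)| := by exact_mod_cast Int.one_le_abs h
    have h2 := abs_sub_abs_le_abs_sub (round t : ℝ) t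
    rw [abs_sub_comm t]
    linarith

lemma residue_recurrence {lam η : ℝ} (hlam : 0 < lam) (hlam1 : lam < 1) {p : ℤ[X]} (hp : p.Monic)
    (hroots : ∀ z ∈ (p.map (Int.castRingHom ℂ)).roots, ‖z‖ < lam ∨ 1 < ‖z‖)
    (hη : 2 * η * ∑ k ∈ Finset.range (p.natDegree + 1), |(p.coeff k : ℝ)| < 1)
    {x : ℕ → ℝ}
    (hrec : ∀ n, ∑ k ∈ Finset.range (p.natDegree + 1), (p.coeff k : ℝ) * x (n + k) = 0)
    (hx : ∀ᶠ n in Filter.atTop, |x n - round (x n)| ≤ 2 * η) :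
    (∀ᶠ n in Filter.atTop, ∑ k ∈ Finset.range (p.natDegree + 1),
      (p.coeff k : ℝ) * (x (n + k) - round (x (n + k))) = 0) ∧
    ∃ C, ∀ n, |x n - round (x n)| ≤ C * lam ^ n := by
  obtain ⟨N, hN⟩ := Filter.eventually_atTop.1 hx
  have hr : ∀ n ≥ N, ∑ k ∈ Finset.range (p.natDegree + 1),
      (p.coeff k : ℝ) * (x (n + k) - round (x (n + k))) = 0 := by
    intro n hn
    have hint : ∑ k ∈ Finset.range (p.natDegree + 1),
        (p.coeff k : ℝ) * (x (n + k) - round (x (n + k))) =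
        ((-∑ k ∈ Finset.range (p.natDegree + 1), p.coeff k * round (x (n + k)) : ℤ) : ℝ) := by
      simp only [mul_sub, Finset.sum_sub_distrib, hrec n]
      push_cast
      ring
    have hsmall : |∑ k ∈ Finset.range (p.natDegree + 1),
        (p.coeff k : ℝ) * (x (n + k) - round (x (n + k)))| < 1 := by
      refine lt_of_le_of_lt (Finset.abs_sum_le_sum_abs _ _) (lt_of_le_of_lt ?_ hη)
      rw [Finset.mul_sum]
      refine Finset.sum_le_sum fun k _ => ?_
      rw [abs_mul, mul_comm]
      gcongr
      exact hN _ (by omega)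
    rw [hint] at hsmall ⊢
    have : |(-∑ k ∈ Finset.range (p.natDegree + 1), p.coeff k * round (x (n + k)) : ℤ)| < 1 := by
      exact_mod_cast hsmall
    rw [Int.abs_lt_one_iff.1 this, Int.cast_zero]
  refine ⟨Filter.eventually_atTop.2 ⟨N, hr⟩, ?_⟩
  obtain ⟨C, hC⟩ := decay_of_recurrence hlam hlam1 hp hroots
    (a := fun n => x (N + n) - round (x (N + n))) (B := 1 / 2) (fun n => abs_sub_round _)
    (fun n => by simpa only [add_assoc] using hr (N + n) (by omega))
  have hC0 : 0 ≤ C := by simpa using (abs_nonneg _).trans (hC 0)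
  refine ⟨(C + 1) / lam ^ N, fun n => ?_⟩
  rw [div_mul_eq_mul_div, le_div_iff₀ (by positivity)]
  rcases le_total N n with h | h
  · obtain ⟨m, rfl⟩ := Nat.exists_eq_add_of_le h
    calc _ ≤ C * lam ^ m * lam ^ N := by gcongr; exact hC m
      _ = C * lam ^ (N + m) := by ring
      _ ≤ _ := by gcongr; linarith
  · have h1 : lam ^ N ≤ lam ^ n := pow_le_pow_of_le_one hlam.le hlam1.le h
    have h2 := abs_sub_round (x n)
    have h3 : 0 < lam ^ n := by positivity
    calc _ ≤ 1 * lam ^ n := by gcongr; linarith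
      _ ≤ _ := by gcongr; linarith

lemma abs_le_of_recurrence {p : ℤ[X]} (hp0 : p.coeff 0 ≠ 0) {a : ℕ → ℝ} {n : ℕ}
    (hrec : ∑ k ∈ Finset.range (p.natDegree + 1), (p.coeff k : ℝ) * a (n + k) = 0)
    {E : ℝ} (hE : 0 ≤ E) (h : ∀ m > n, |a m| ≤ E) :
    |a n| ≤ (∑ k ∈ Finset.range (p.natDegree + 1), |(p.coeff k : ℝ)|) * E := by
  have h1 : (1 : ℝ) ≤ |(p.coeff 0 : ℝ)| := by exact_mod_cast Int.one_le_abs hp0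
  rw [Finset.sum_range_succ'] at hrec ⊢
  calc |a n| ≤ |(p.coeff 0 : ℝ)| * |a n| := le_mul_of_one_le_left (abs_nonneg _) h1
    _ = |∑ k ∈ Finset.range p.natDegree, (p.coeff (k + 1) : ℝ) * a (n + (k + 1))| := by
        rw [← abs_mul, ← abs_neg]; congr 1; simp at hrec ⊢; linarith
    _ ≤ ∑ k ∈ Finset.range p.natDegree, |(p.coeff (k + 1) : ℝ)| * E := by
        refine (Finset.abs_sum_le_sum_abs _ _).trans (Finset.sum_le_sum fun k _ => ?_)
        rw [abs_mul]; gcongr; exact h _ (by omega)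
    _ ≤ _ := by
        rw [← Finset.sum_mul]; gcongr; linarith [abs_nonneg (p.coeff 0 : ℝ)]

lemma abs_le_pow_of_recurrence {p : ℤ[X]} (hp0 : p.coeff 0 ≠ 0) {a : ℕ → ℝ}
    (hrec : ∀ n, ∑ k ∈ Finset.range (p.natDegree + 1), (p.coeff k : ℝ) * a (n + k) = 0)
    (hP : 1 ≤ ∑ k ∈ Finset.range (p.natDegree + 1), |(p.coeff k : ℝ)|)
    {E : ℝ} (hE : 0 ≤ E) {N : ℕ} (h : ∀ m ≥ N, |a m| ≤ E) (t m : ℕ) (hm : N ≤ m + t) :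
    |a m| ≤ (∑ k ∈ Finset.range (p.natDegree + 1), |(p.coeff k : ℝ)|) ^ t * E := by
  induction t generalizing m with
  | zero => simpa using h m hm
  | succ t ih =>
    rw [pow_succ', mul_assoc]
    exact abs_le_of_recurrence hp0 (hrec m) (by positivity) fun m' hm' => ih m' (by omega)

lemma eq_zero_of_decay {d : ℕ} {lam η C : ℝ} (hlam : 0 < lam) (hlam1 : lam < 1) (hη : 0 < η)
    {p : ℤ[X]} (hp0 : p.coeff 0 ≠ 0)
    (hP : 1 ≤ ∑ k ∈ Finset.range (p.natDegree + 1), |(p.coeff k : ℝ)|)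
    (hηP : 4 * η * ∑ k ∈ Finset.range (p.natDegree + 1), |(p.coeff k : ℝ)| ≤ 1)
    {M : ℕ → ℕ} {ι : ℕ → Fin d} (hM : ∀ j, 1 ≤ M j)
    (hgrow : ∀ K t : ℕ, ∀ᶠ j in Filter.atTop, K * (K ^ j * ∑ l ∈ Finset.range j, M l) ^ t < M j)
    (hι : ∀ i, ∃ᶠ j in Filter.atTop, ι j = i)
    {v : ℕ → Fin d → ℝ}
    (hrec : ∀ i n, ∑ k ∈ Finset.range (p.natDegree + 1), (p.coeff k : ℝ) * v (n + k) i = 0)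
    (hC : ∀ n i, |v n i| ≤ C * lam ^ n)
    (hstar : ∀ n j, η ^ j * |M j * v n (ι j) - round (M j * v n (ι j))| ≤
      2 * ∑ l ∈ Finset.range j, |M l * v n (ι l) - round (M l * v n (ι l))| + η ^ (j + 1)) :
    v 0 = 0 := by
  by_contra hne
  obtain ⟨i, hi⟩ := Function.ne_iff.1 hne
  set P := ∑ k ∈ Finset.range (p.natDegree + 1), |(p.coeff k : ℝ)| with hPdef
  have hα : 0 < |v 0 i| := abs_pos.2 hi
  obtain ⟨C, hC1, hC⟩ : ∃ C', 1 ≤ C' ∧ ∀ n i, |v n i| ≤ C' * lam ^ n :=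
    ⟨max C 1, le_max_right _ _, fun n i => (hC n i).trans (by gcongr; exact le_max_left _ _)⟩
  obtain ⟨t, ht⟩ : ∃ t : ℕ, lam ^ t < P⁻¹ := exists_pow_lt_of_lt_one (by positivity) hlam1
  obtain ⟨K, hK⟩ := exists_nat_ge (max (1 / (2 * |v 0 i|)) (8 * P * C / η))
  have hK1 := (le_max_left _ _).trans hK
  have hK2 := (le_max_right _ _).trans hK
  obtain ⟨j, hj, hgj, hj1⟩ := ((hι i).and_eventually
    ((hgrow K t).and (Filter.eventually_ge_atTop 1))).exists
  have hKpos : 0 < K := by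
    have : (0 : ℝ) < K := lt_of_lt_of_le (by positivity) hK1
    exact_mod_cast this
  set U := ∑ l ∈ Finset.range j, M l with hU
  have hU1 : 1 ≤ U := (hM 0).trans
    (Finset.single_le_sum (f := M) (fun _ _ => Nat.zero_le _) (Finset.mem_range.2 hj1))
  have hMK : K < M j := lt_of_le_of_lt
    (Nat.le_mul_of_pos_right _ (by positivity)) hgj
  have hMpos : (0 : ℝ) < M j := by exact_mod_cast hM j
  have hMα : 1 / 2 < M j * |v 0 i| := by
    have h1 : (K : ℝ) < M j := by exact_mod_cast hMK
    rw [div_le_iff₀ (by positivity)] at hK1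
    nlinarith
  have hex : ∃ N, ∀ m ≥ N, M j * |v m i| ≤ 1 / 2 := by
    have ht : Filter.Tendsto (fun m : ℕ => M j * (C * lam ^ m)) Filter.atTop
        (𝓝 (M j * (C * 0))) :=
      ((tendsto_pow_atTop_nhds_zero_of_lt_one hlam.le hlam1).const_mul C).const_mul _
    rw [mul_zero, mul_zero] at ht
    obtain ⟨N, hN⟩ := Filter.eventually_atTop.1 (ht.eventually_le_const (by norm_num : (0:ℝ) < 1/2))
    exact ⟨N, fun m hm => le_trans (by gcongr; exact hC m i) (hN m hm)⟩
  classical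
  set N := Nat.find hex with hNdef
  have hN : ∀ m ≥ N, M j * |v m i| ≤ 1 / 2 := Nat.find_spec hex
  obtain ⟨n, hn⟩ : ∃ n, N = n + 1 := Nat.exists_eq_succ_of_ne_zero (by
    intro h0
    exact absurd (hN 0 (by omega)) (not_le.2 hMα))
  have hnbig : 1 / 2 < M j * |v n i| := by
    have := Nat.find_min hex (m := n) (by omega)
    push Not at this
    obtain ⟨m, hm, hm'⟩ := this
    have : m = n := by
      by_contra hmn
      exact absurd (hN m (by omega)) (not_le.2 hm')
    rwa [this] at hm'
  have hsmall : ∀ m ≥ N, |v m i| ≤ 1 / (2 * M j) := fun m hm => by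
    rw [le_div_iff₀ (by positivity)]; linarith [hN m hm]
  have hback := abs_le_pow_of_recurrence hp0 (a := fun n => v n i) (hrec i) hP
    (by positivity) hsmall N 0 (by omega)
  obtain ⟨m, hm, hmbig⟩ : ∃ m > n, 1 / (2 * P * M j) < |v m i| := by
    by_contra! hcon
    have h1 := abs_le_of_recurrence hp0 (a := fun n => v n i) (hrec i n) (by positivity) hcon
    have h2 : P * (1 / (2 * P * M j)) = 1 / (2 * M j) := by
      have : P ≠ 0 := by positivity
      field_simp
    rw [← hPdef, h2, le_div_iff₀ (by positivity)] at h1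
    linarith
  have hst := hstar m j
  rw [hj, abs_sub_round_eq_abs (by rw [abs_mul, Nat.abs_cast]; exact hN m (by omega)), abs_mul,
    Nat.abs_cast] at hst
  have hsum : ∑ l ∈ Finset.range j, |M l * v m (ι l) - round (M l * v m (ι l))| ≤
      U * (C * lam ^ N) := by
    rw [hU]; push_cast; rw [Finset.sum_mul]
    refine Finset.sum_le_sum fun l _ => ?_
    have h1 := round_le ((M l : ℝ) * v m (ι l)) 0
    rw [Int.cast_zero, sub_zero, abs_mul, Nat.abs_cast] at h1
    refine h1.trans ?_
    gcongr
    exact (hC m _).trans (mul_le_mul_of_nonneg_left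
      (pow_le_pow_of_le_one hlam.le hlam1.le (by omega)) (by linarith))
  have hP0 : 0 < P := by positivity
  have hηj : 0 < η ^ j := by positivity
  have hlow : 1 / (2 * P) < M j * |v m i| := by
    rw [div_lt_iff₀ (by positivity)] at hmbig ⊢
    linarith
  have hineq : η ^ j < 8 * P * C * U * lam ^ N := by
    have h1 : η ^ j * (1 / (2 * P)) < 2 * (U * (C * lam ^ N)) + η ^ (j + 1) := by
      have := mul_lt_mul_of_pos_left hlow hηj
      linarith
    have h2 : η ^ (j + 1) ≤ η ^ j * (1 / (4 * P)) := by
      rw [pow_succ]; gcongr; rw [le_div_iff₀ (by positivity)]; linarith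
    have h3 : η ^ j * (1 / (2 * P)) - η ^ j * (1 / (4 * P)) = η ^ j / (4 * P) := by
      field_simp; ring
    have h4 : η ^ j / (4 * P) < 2 * (U * (C * lam ^ N)) := by linarith
    rw [div_lt_iff₀ (by positivity)] at h4
    linarith
  have hone : 1 ≤ (K : ℝ) ^ j * U * lam ^ N := by
    have h1 : 8 * P * C ≤ (K * η) ^ j := by
      rw [div_le_iff₀ hη] at hK2
      have : 1 ≤ (8 * P * C) := by nlinarith
      calc 8 * P * C ≤ (8 * P * C) ^ j := le_self_pow₀ this (by omega)
        _ ≤ _ := by gcongr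
    have h2 : η ^ j < (K * η) ^ j * U * lam ^ N := lt_of_lt_of_le hineq (by gcongr)
    rw [mul_pow] at h2
    have h3 : η ^ j * 1 < η ^ j * ((K : ℝ) ^ j * U * lam ^ N) := by linarith
    exact (lt_of_mul_lt_mul_left h3 hηj.le).le
  have hfin : (M j : ℝ) ≤ K * (K ^ j * U) ^ t := by
    have h1 : 1 ≤ ((K : ℝ) ^ j * U) ^ t * (P⁻¹) ^ N := by
      calc (1 : ℝ) ≤ ((K : ℝ) ^ j * U * lam ^ N) ^ t := one_le_pow₀ hone
        _ = ((K : ℝ) ^ j * U) ^ t * (lam ^ t) ^ N := by rw [mul_pow, ← pow_mul, ← pow_mul, mul_comm N]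
        _ ≤ _ := by gcongr
    have h2 : P ^ N ≤ ((K : ℝ) ^ j * U) ^ t := by
      rwa [inv_pow, ← div_eq_mul_inv, le_div_iff₀ (by positivity), one_mul] at h1
    have h3 : |v 0 i| * (2 * M j) ≤ P ^ N := by
      rw [mul_one_div, le_div_iff₀ (by positivity)] at hback
      exact hback
    have h4 : (M j : ℝ) = 1 / (2 * |v 0 i|) * (|v 0 i| * (2 * M j)) := by field_simp
    rw [h4]
    gcongr
    exact h3.trans h2
  exact absurd (by exact_mod_cast hfin) (not_le.2 hgj)

lemma exists_superexponential (d : ℕ) : ∃ M : ℕ → ℕ, (∀ j, 1 ≤ M j) ∧ (∀ j < d, M j = 1) ∧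
    ∀ K t : ℕ, ∀ᶠ j in Filter.atTop, K * (K ^ j * ∑ l ∈ Finset.range j, M l) ^ t < M j := by
  let m : ℕ → ℕ → ℕ := fun j u => if j < d then 1 else 1 + j * (j ^ j * u) ^ j
  let U : ℕ → ℕ := fun j => Nat.rec 0 (fun j u => u + m j u) j
  have hU : ∀ j, ∑ l ∈ Finset.range j, m l (U l) = U j := by
    intro j
    induction j with
    | zero => rfl
    | succ j ih => rw [Finset.sum_range_succ, ih]
  have hm : ∀ j u, 1 ≤ m j u := by
    intro j u
    simp only [m]
    split_ifs <;> omega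
  refine ⟨fun j => m j (U j), fun j => hm _ _, fun j hj => if_pos hj, fun K t => ?_⟩
  filter_upwards [Filter.eventually_ge_atTop K, Filter.eventually_ge_atTop t,
    Filter.eventually_ge_atTop d, Filter.eventually_ge_atTop 1] with j hK ht hd h1
  rw [hU]
  have hU1 : 1 ≤ U j := by
    rw [← hU]
    exact (hm 0 (U 0)).trans (Finset.single_le_sum (f := fun l => m l (U l))
      (fun _ _ => Nat.zero_le _) (Finset.mem_range.2 h1))
  have hval : m j (U j) = 1 + j * (j ^ j * U j) ^ j := if_neg (by omega)
  rw [hval]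
  have hpos : 1 ≤ j ^ j * U j := Nat.mul_pos (by positivity) hU1
  calc K * (K ^ j * U j) ^ t ≤ j * (j ^ j * U j) ^ t := by gcongr
    _ ≤ j * (j ^ j * U j) ^ j := by gcongr
    _ < _ := by omega

lemma charpoly_recurrence {d : ℕ} (A : Matrix (Fin d) (Fin d) ℤ) (κ : Fin d → ℝ) (i : Fin d)
    (n : ℕ) :
    ∑ k ∈ Finset.range (A.charpoly.natDegree + 1), (A.charpoly.coeff k : ℝ) *
      ((A.map (Int.cast : ℤ → ℝ)) ^ (n + k)).mulVec κ i = 0 := by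
  have h := Matrix.aeval_self_charpoly A
  rw [aeval_eq_sum_range] at h
  have h2 := congrArg (Int.castRingHom ℝ).mapMatrix h
  rw [map_sum, map_zero] at h2
  have h3 : ∑ k ∈ Finset.range (A.charpoly.natDegree + 1), (A.charpoly.coeff k : ℝ) •
      (A.map (Int.cast : ℤ → ℝ)) ^ k = 0 := by
    rw [← h2]
    refine Finset.sum_congr rfl fun k _ => ?_
    rw [zsmul_eq_mul, map_mul, map_pow, map_intCast, ← zsmul_eq_mul, ← Int.cast_smul_eq_zsmul ℝ]
    rfl
  have h4 := congrFun (congrArg (fun X => X.mulVec (((A.map (Int.cast : ℤ → ℝ)) ^ n).mulVec κ)) h3) i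
  simp only [Matrix.sum_mulVec, Matrix.smul_mulVec, Matrix.zero_mulVec, Finset.sum_apply,
    Pi.smul_apply, smul_eq_mul, Pi.zero_apply] at h4
  simp only [Matrix.mulVec_mulVec, ← pow_add] at h4
  simpa only [add_comm n] using h4

lemma exists_rate (s : Multiset ℂ) (hs : ∀ z ∈ s, ‖z‖ ≠ 1) :
    ∃ lam : ℝ, 0 < lam ∧ lam < 1 ∧ ∀ z ∈ s, ‖z‖ < lam ∨ 1 < ‖z‖ := by
  have h1 : ∀ᶠ lam in 𝓝[<] (1 : ℝ), ∀ z ∈ s.toFinset, ‖z‖ < lam ∨ 1 < ‖z‖ := by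
    rw [Filter.eventually_all_finset]
    intro z hz
    rcases lt_or_gt_of_ne (hs z (Multiset.mem_toFinset.1 hz)) with h | h
    · exact (eventually_nhdsWithin_of_eventually_nhds (lt_mem_nhds h)).mono fun _ => Or.inl
    · exact Filter.Eventually.of_forall fun _ => Or.inr h
  have h2 : ∀ᶠ lam in 𝓝[<] (1 : ℝ), 0 < lam :=
    eventually_nhdsWithin_of_eventually_nhds (lt_mem_nhds one_pos)
  obtain ⟨lam, h⟩ := (h1.and (h2.and self_mem_nhdsWithin)).exists
  exact ⟨lam, h.2.1, h.2.2, fun z hz => h.1 z (Multiset.mem_toFinset.2 hz)⟩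

lemma det_mul_mem_int {d : ℕ} (A : Matrix (Fin d) (Fin d) ℤ) {v : Fin d → ℝ} {z : Fin d → ℤ}
    (h : (A.map (Int.cast : ℤ → ℝ)).mulVec v = fun i => (z i : ℝ)) (i : Fin d) :
    ∃ w : ℤ, (A.det : ℝ) * v i = w := by
  have h1 : (A.map (Int.cast : ℤ → ℝ)).adjugate = A.adjugate.map (Int.cast : ℤ → ℝ) :=
    ((Int.castRingHom ℝ).map_adjugate A).symm
  have h2 : (A.map (Int.cast : ℤ → ℝ)).det = A.det := ((Int.castRingHom ℝ).map_det A).symm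
  have h3 := congrFun (congrArg (A.map (Int.cast : ℤ → ℝ)).adjugate.mulVec h) i
  rw [Matrix.mulVec_mulVec, Matrix.adjugate_mul, h2, h1, Matrix.smul_mulVec, Matrix.one_mulVec,
    Pi.smul_apply, smul_eq_mul] at h3
  refine ⟨A.adjugate.mulVec z i, ?_⟩
  rw [h3]
  simp [Matrix.mulVec, dotProduct]

lemma inv_le_abs_sub_round {q : ℤ} (hq : q ≠ 0) {t : ℝ} (h : ∃ w : ℤ, (q : ℝ) * t = w) (ht : t - round t ≠ 0) :
    1 ≤ |(q : ℝ)| * |t - round t| := by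
  obtain ⟨w, hw⟩ := h
  have h1 : (q : ℝ) * (t - round t) = ((w - q * round t : ℤ) : ℝ) := by
    push_cast; rw [mul_sub, hw]
  rw [← abs_mul, h1]
  have h2 : (w - q * round t : ℤ) ≠ 0 := by
    intro h0
    rw [h0, Int.cast_zero] at h1
    exact (mul_ne_zero (by exact_mod_cast hq) ht) h1
  exact_mod_cast Int.one_le_abs h2

lemma eventually_integral {d : ℕ} {lam η : ℝ} (hlam : 0 < lam) (hlam1 : lam < 1) (hη0 : 0 < η)
    {p : ℤ[X]} (hmonic : p.Monic) (hp0 : p.coeff 0 ≠ 0)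
    (hroots : ∀ z ∈ (p.map (Int.castRingHom ℂ)).roots, ‖z‖ < lam ∨ 1 < ‖z‖)
    (hP : 1 ≤ ∑ k ∈ Finset.range (p.natDegree + 1), |(p.coeff k : ℝ)|)
    (hηP : 4 * η * ∑ k ∈ Finset.range (p.natDegree + 1), |(p.coeff k : ℝ)| ≤ 1)
    {M : ℕ → ℕ} {ι : ℕ → Fin d} (hM1 : ∀ j, 1 ≤ M j)
    (hgrow : ∀ K t : ℕ, ∀ᶠ j in Filter.atTop, K * (K ^ j * ∑ l ∈ Finset.range j, M l) ^ t < M j)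
    (hι : ∀ i, ∃ᶠ j in Filter.atTop, ι j = i) (hιd : ∀ i : Fin d, ι i = i)
    {v : ℕ → Fin d → ℝ}
    (hrec : ∀ i n, ∑ k ∈ Finset.range (p.natDegree + 1), (p.coeff k : ℝ) * v (n + k) i = 0)
    (hstarv : ∀ n j, η ^ j * |M j * v n (ι j) - round (M j * v n (ι j))| ≤
      2 * ∑ l ∈ Finset.range j, |M l * v n (ι l) - round (M l * v n (ι l))| + η ^ (j + 1))
    (hstard : ∀ n (i : Fin d), η ^ (i : ℕ) * |v n i - round (v n i)| ≤
      2 * ∑ l ∈ Finset.range i, |v n (ι l) - round (v n (ι l))| + η ^ ((i : ℕ) + 1)) :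
    ∃ n, ∃ z : Fin d → ℤ, v n = fun i => (z i : ℝ) := by
  have hres : ∀ (m : ℕ) (i : Fin d), (i : ℕ) = m →
      (∀ᶠ n in Filter.atTop, ∑ k ∈ Finset.range (p.natDegree + 1),
        (p.coeff k : ℝ) * (v (n + k) i - round (v (n + k) i)) = 0) ∧
      ∃ C, ∀ n, |v n i - round (v n i)| ≤ C * lam ^ n := by
    intro m
    induction m using Nat.strong_induction_on with
    | _ m ih =>
    rintro i rfl
    refine residue_recurrence hlam hlam1 hmonic hroots (η := η) (by linarith)
      (x := fun n => v n i) (hrec i) ?_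
    have hlim : Filter.Tendsto (fun n => 2 * ∑ l ∈ Finset.range (i : ℕ),
        |v n (ι l) - round (v n (ι l))|) Filter.atTop (𝓝 (2 * ∑ l ∈ Finset.range (i : ℕ), 0)) := by
      refine Filter.Tendsto.const_mul _ (tendsto_finsetSum _ fun l hl => ?_)
      rw [Finset.mem_range] at hl
      obtain ⟨C, hC⟩ := (ih l hl (ι l) (congrArg Fin.val (hιd ⟨l, hl.trans i.2⟩))).2
      refine squeeze_zero (fun _ => abs_nonneg _) hC ?_
      simpa using (tendsto_pow_atTop_nhds_zero_of_lt_one hlam.le hlam1).const_mul C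
    rw [Finset.sum_const_zero, mul_zero] at hlim
    filter_upwards [hlim.eventually_le_const (show 0 < η ^ ((i : ℕ) + 1) by positivity)] with n hn
    have h := hstard n i
    have h2 : η ^ (i : ℕ) * |v n i - round (v n i)| ≤ η ^ (i : ℕ) * (2 * η) := by
      rw [pow_succ] at h hn
      linarith
    exact le_of_mul_le_mul_left h2 (by positivity)
  obtain ⟨N, hN⟩ := Filter.eventually_atTop.1
    (Filter.eventually_all.2 fun i : Fin d => (hres i i rfl).1)
  choose C hC using fun i : Fin d => (hres i i rfl).2
  have hz := eq_zero_of_decay hlam hlam1 hη0 hp0 hP (by linarith) hM1 hgrow hι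
    (v := fun n i => v (N + n) i - round (v (N + n) i)) (C := (∑ i, |C i|) * lam ^ N)
    (fun i n => by simpa only [add_assoc] using hN (N + n) (by omega) i)
    (fun n i => by
      rw [mul_assoc, ← pow_add]
      refine (hC i _).trans ?_
      gcongr
      exact (le_abs_self _).trans (Finset.single_le_sum (f := fun i => |C i|)
        (fun _ _ => abs_nonneg _) (Finset.mem_univ i)))
    (fun n j => by
      have hinv : ∀ l : ℕ, |(M l : ℝ) * (v (N + n) (ι l) - round (v (N + n) (ι l))) -
          round ((M l : ℝ) * (v (N + n) (ι l) - round (v (N + n) (ι l))))| =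
          |(M l : ℝ) * v (N + n) (ι l) - round ((M l : ℝ) * v (N + n) (ι l))| := by
        intro l
        have : (M l : ℝ) * (v (N + n) (ι l) - round (v (N + n) (ι l))) =
            M l * v (N + n) (ι l) - ((M l * round (v (N + n) (ι l)) : ℤ) : ℝ) := by
          push_cast; ring
        rw [this, round_sub_intCast]
        push_cast
        congr 1
        ring
      simp only [hinv]
      exact hstarv (N + n) j)
  refine ⟨N, fun i => round (v N i), funext fun i => ?_⟩
  have := congrFun hz i
  simpa [sub_eq_zero] using this

lemma exists_rigid_scales {d : ℕ} (hd : 0 < d) (A : Matrix (Fin d) (Fin d) ℤ) (hdet : A.det ≠ 0)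
    (hhyp : ∀ z : ℂ, ((A.map (Int.cast : ℤ → ℂ)).charpoly).IsRoot z → ‖z‖ ≠ 1) :
    ∃ η : ℝ, 0 < η ∧ η ≤ 1 / 2 ∧ ∃ (M : ℕ → ℕ) (ι : ℕ → Fin d), ∀ κ : Fin d → ℝ,
      (∀ n j, η ^ j * |M j * ((A.map (Int.cast : ℤ → ℝ)) ^ n).mulVec κ (ι j) -
          round (M j * ((A.map (Int.cast : ℤ → ℝ)) ^ n).mulVec κ (ι j))| ≤
        2 * ∑ l ∈ Finset.range j, |M l * ((A.map (Int.cast : ℤ → ℝ)) ^ n).mulVec κ (ι l) -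
          round (M l * ((A.map (Int.cast : ℤ → ℝ)) ^ n).mulVec κ (ι l))| + η ^ (j + 1)) →
      ∃ z : Fin d → ℤ, κ = fun i => (z i : ℝ) := by
  set p := A.charpoly with hp
  set P := ∑ k ∈ Finset.range (p.natDegree + 1), |(p.coeff k : ℝ)| with hPdef
  have hmonic : p.Monic := A.charpoly_monic
  have hP : 1 ≤ P := by
    refine le_trans ?_ (Finset.single_le_sum (f := fun k => |(p.coeff k : ℝ)|)
      (fun _ _ => abs_nonneg _) (Finset.self_mem_range_succ p.natDegree))
    simp [hmonic.coeff_natDegree]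
  have hp0 : p.coeff 0 ≠ 0 := by
    intro h0
    rw [Matrix.det_eq_sign_charpoly_coeff, ← hp, h0, mul_zero] at hdet
    exact hdet rfl
  have hq : (1 : ℝ) ≤ |(A.det : ℝ)| := by exact_mod_cast Int.one_le_abs hdet
  obtain ⟨lam, hlam, hlam1, hroots⟩ := exists_rate (p.map (Int.castRingHom ℂ)).roots (by
    intro z hz
    refine hhyp z ?_
    have := Polynomial.isRoot_of_mem_roots hz
    rw [hp, ← Matrix.charpoly_map] at this
    exact this)
  obtain ⟨M, hM1, hMd, hgrow⟩ := exists_superexponential d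
  obtain ⟨η, hη0, hηmul⟩ : ∃ η : ℝ, 0 < η ∧ η * (8 * (P + |(A.det : ℝ)|)) = 1 :=
    ⟨1 / (8 * (P + |(A.det : ℝ)|)), by positivity, one_div_mul_cancel (by positivity)⟩
  have hηhalf : η ≤ 1 / 2 := by nlinarith
  have hηq0 : 0 < η * |(A.det : ℝ)| := by positivity
  have hηP0 : 0 < η * P := by positivity
  set ι : ℕ → Fin d := fun j => ⟨j % d, Nat.mod_lt _ hd⟩ with hιdef
  have hι : ∀ i, ∃ᶠ j in Filter.atTop, ι j = i := by
    intro i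
    rw [Filter.frequently_atTop]
    intro a
    refine ⟨d * a + i, ?_, Fin.ext ?_⟩
    · nlinarith
    · simp [hιdef, Nat.mod_eq_of_lt i.2]
  have hιd : ∀ i : Fin d, ι i = i := fun i => Fin.ext (Nat.mod_eq_of_lt i.2)
  refine ⟨η, hη0, hηhalf, M, ι, ?_⟩
  intro κ hstar
  set v : ℕ → Fin d → ℝ := fun n => ((A.map (Int.cast : ℤ → ℝ)) ^ n).mulVec κ with hv
  have hrec : ∀ i n, ∑ k ∈ Finset.range (p.natDegree + 1), (p.coeff k : ℝ) * v (n + k) i = 0 :=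
    fun i n => charpoly_recurrence A κ i n
  have hstarv : ∀ n j, η ^ j * |M j * v n (ι j) - round (M j * v n (ι j))| ≤
      2 * ∑ l ∈ Finset.range j, |M l * v n (ι l) - round (M l * v n (ι l))| + η ^ (j + 1) := hstar
  have hstard : ∀ n (i : Fin d), η ^ (i : ℕ) * |v n i - round (v n i)| ≤
      2 * ∑ l ∈ Finset.range i, |v n (ι l) - round (v n (ι l))| + η ^ ((i : ℕ) + 1) := by
    intro n i
    have h := hstarv n i
    rw [hMd i i.2, hιd, Nat.cast_one, one_mul] at h
    convert h using 3
    refine Finset.sum_congr rfl fun l hl => ?_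
    rw [hMd l ((Finset.mem_range.1 hl).trans i.2), Nat.cast_one, one_mul]
  clear hstar
  have hfinal := eventually_integral hlam hlam1 hη0 hmonic hp0 hroots hP (by linarith) hM1 hgrow hι
    hιd hrec hstarv hstard
  classical
  obtain ⟨z, hz⟩ := Nat.find_spec hfinal
  rcases Nat.eq_zero_or_pos (Nat.find hfinal) with h0 | hpos
  · rw [h0] at hz
    exact ⟨z, by simpa [hv] using hz⟩
  exfalso
  obtain ⟨n, hn⟩ := Nat.exists_eq_succ_of_ne_zero hpos.ne'
  have hnot := Nat.find_min hfinal (m := n) (by omega)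
  rw [hn] at hz
  have hstep : (A.map (Int.cast : ℤ → ℝ)).mulVec (v n) = fun i => (z i : ℝ) := by
    rw [← hz]
    simp only [hv, Matrix.mulVec_mulVec, Nat.succ_eq_add_one, pow_succ']
  have hex : ∃ m : ℕ, ∃ hm : m < d, v n ⟨m, hm⟩ - round (v n ⟨m, hm⟩) ≠ 0 := by
    by_contra! hcon
    exact hnot ⟨fun i => round (v n i), funext fun i => sub_eq_zero.1 (hcon i i.2)⟩
  obtain ⟨hm, hmne⟩ := Nat.find_spec hex
  have hsum : ∑ l ∈ Finset.range (Nat.find hex), |v n (ι l) - round (v n (ι l))| = 0 := by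
    refine Finset.sum_eq_zero fun l hl => ?_
    have hl' := Finset.mem_range.1 hl
    have hmin := Nat.find_min hex hl'
    push Not at hmin
    have := hmin (hl'.trans hm)
    rw [← hιd ⟨l, hl'.trans hm⟩] at this
    rw [this, abs_zero]
  have hlast := hstard n ⟨Nat.find hex, hm⟩
  simp only [hsum, mul_zero, zero_add, pow_succ] at hlast
  have hle := le_of_mul_le_mul_left hlast (by positivity)
  have hge := inv_le_abs_sub_round hdet (det_mul_mem_int A hstep ⟨_, hm⟩) hmne
  have : |(A.det : ℝ)| * |v n ⟨Nat.find hex, hm⟩ - round (v n ⟨Nat.find hex, hm⟩)| ≤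
      |(A.det : ℝ)| * η := by gcongr
  linarith

end

lemma norm_exp_sub_one_bounds (u : ℝ) :
    4 * |u - round u| ≤ ‖Complex.exp (Complex.I * (2 * Real.pi * u : ℝ)) - 1‖ ∧
    ‖Complex.exp (Complex.I * (2 * Real.pi * u : ℝ)) - 1‖ ≤ 7 * |u - round u| := by
  have hsin : |Real.sin (2 * Real.pi * u / 2)| = |Real.sin (Real.pi * (u - round u))| := by
    have : Real.pi * (u - round u) = 2 * Real.pi * u / 2 - (round u : ℤ) * Real.pi := by ring
    rw [this, Real.sin_sub_int_mul_pi, abs_mul, abs_zpow, abs_neg, abs_one, one_zpow, one_mul]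
  have hpi := Real.pi_pos
  have habs : |Real.pi * (u - round u)| = Real.pi * |u - round u| := by
    rw [abs_mul, abs_of_pos hpi]
  have hr := abs_sub_round u
  rw [Complex.norm_exp_I_mul_ofReal_sub_one, norm_mul, Real.norm_eq_abs, Real.norm_eq_abs, hsin,
    abs_two]
  constructor
  · have h := Real.mul_abs_le_abs_sin (x := Real.pi * (u - round u)) (by rw [habs]; nlinarith)
    rw [habs, ← mul_assoc, div_mul_cancel₀ _ hpi.ne'] at h
    linarith
  · have h := Real.abs_sin_le_abs (x := Real.pi * (u - round u))
    rw [habs] at h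
    nlinarith [Real.pi_lt_d2, abs_nonneg (u - round u)]

lemma norm_fourier_sub_bounds (m : ℕ) {x y : UnitAddCircle} {t : ℝ} (ht : (t : UnitAddCircle) = y - x) :
    4 * |m * t - round (m * t)| ≤ ‖fourier (T := 1) (m : ℤ) y - fourier (m : ℤ) x‖ ∧
    ‖fourier (T := 1) (m : ℤ) y - fourier (m : ℤ) x‖ ≤ 7 * |m * t - round (m * t)| := by
  have h : ‖fourier (T := 1) (m : ℤ) y - fourier (m : ℤ) x‖ =
      ‖Complex.exp (Complex.I * (2 * Real.pi * (m * t) : ℝ)) - 1‖ := by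
    have h1 : fourier (T := 1) (m : ℤ) y = fourier (m : ℤ) x * fourier (m : ℤ) (t : UnitAddCircle) := by
      rw [ht, fourier_apply, fourier_apply, fourier_apply, ← Circle.coe_mul, ← AddCircle.toCircle_add,
        ← smul_add, add_sub_cancel]
    have h2 : ‖fourier (T := 1) (m : ℤ) x‖ = 1 := Circle.norm_coe _
    rw [h1, ← mul_sub_one, norm_mul, h2, one_mul, fourier_coe_apply]
    congr 3
    push_cast
    ring
  rw [h]
  exact norm_exp_sub_one_bounds _

/-- The lacunary Fourier series `∑ⱼ ηʲ e(Mⱼ x_{ι j})` on the torus. -/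
noncomputable def lacunarySeries {d : ℕ} (η : ℝ) (M : ℕ → ℕ) (ι : ℕ → Fin d)
    (x : Fin d → UnitAddCircle) : ℂ :=
  ∑' j, (η : ℂ) ^ j * fourier (M j : ℤ) (x (ι j))

lemma norm_lacunary_term {η : ℝ} (hη : 0 < η) (m : ℤ) (j : ℕ) (x : UnitAddCircle) :
    ‖(η : ℂ) ^ j * fourier m x‖ = η ^ j := by
  have h2 : ‖fourier (T := 1) m x‖ = 1 := Circle.norm_coe _
  rw [norm_mul, h2, norm_pow, Complex.norm_real, Real.norm_of_nonneg hη.le, mul_one]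

lemma continuous_lacunarySeries {d : ℕ} {η : ℝ} (hη : 0 < η) (hη1 : η ≤ 1 / 2) (M : ℕ → ℕ)
    (ι : ℕ → Fin d) : Continuous (lacunarySeries η M ι) :=
  continuous_tsum (fun j => continuous_const.mul ((map_continuous _).comp (continuous_apply _)))
    (summable_geometric_of_lt_one hη.le (by linarith))
    (fun j x => (norm_lacunary_term hη _ j _).le)

lemma lacunarySeries_eq_imp {d : ℕ} {η : ℝ} (hη : 0 < η) (hη1 : η ≤ 1 / 2) {M : ℕ → ℕ}
    {ι : ℕ → Fin d} {x y : Fin d → UnitAddCircle} {v : Fin d → ℝ}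
    (hv : ∀ i, (v i : UnitAddCircle) = y i - x i)
    (h : lacunarySeries η M ι x = lacunarySeries η M ι y) (j : ℕ) :
    η ^ j * |M j * v (ι j) - round (M j * v (ι j))| ≤
      2 * ∑ l ∈ Finset.range j, |M l * v (ι l) - round (M l * v (ι l))| + η ^ (j + 1) := by
  have hgeo := summable_geometric_of_lt_one hη.le (by linarith : η < 1)
  have hs : ∀ z : Fin d → UnitAddCircle,
      Summable fun j => (η : ℂ) ^ j * fourier (M j : ℤ) (z (ι j)) := fun z =>
    Summable.of_norm (by simpa only [norm_lacunary_term hη] using hgeo)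
  set g : ℕ → ℂ := fun j => (η : ℂ) ^ j * (fourier (M j : ℤ) (y (ι j)) - fourier (M j : ℤ) (x (ι j)))
    with hg
  have hgs : Summable g := by simpa only [hg, mul_sub] using (hs y).sub (hs x)
  have hg0 : ∑' j, g j = 0 := by
    simp only [hg, mul_sub]
    rw [(hs y).tsum_sub (hs x)]
    exact sub_eq_zero.2 h.symm
  have hnorm : ∀ j, ‖g j‖ = η ^ j * ‖fourier (T := 1) (M j : ℤ) (y (ι j)) - fourier (M j : ℤ) (x (ι j))‖ := by
    intro j
    rw [hg, norm_mul, norm_pow, Complex.norm_real, Real.norm_of_nonneg hη.le]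
  have hlow : η ^ j * (4 * |M j * v (ι j) - round (M j * v (ι j))|) ≤ ‖g j‖ := by
    rw [hnorm]
    gcongr
    exact (norm_fourier_sub_bounds _ (hv _)).1
  have hup : ∀ l, ‖g l‖ ≤ 7 * |M l * v (ι l) - round (M l * v (ι l))| := by
    intro l
    rw [hnorm]
    exact (mul_le_of_le_one_left (norm_nonneg _) (pow_le_one₀ hη.le (by linarith))).trans
      (norm_fourier_sub_bounds _ (hv _)).2
  have htail : ‖∑' l, g (l + (j + 1))‖ ≤ 4 * η ^ (j + 1) := by
    have hsum := (hasSum_geometric_of_lt_one hη.le (by linarith : η < 1)).mul_left (2 * η ^ (j + 1))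
    refine (tsum_of_norm_bounded hsum fun l => ?_).trans ?_
    · rw [hnorm, pow_add]
      have h2 : ∀ z : UnitAddCircle, ‖fourier (T := 1) (M (l + (j + 1)) : ℤ) z‖ = 1 :=
        fun z => Circle.norm_coe _
      have h3 := norm_sub_le (fourier (T := 1) (M (l + (j + 1)) : ℤ) (y (ι (l + (j + 1)))))
        (fourier (M (l + (j + 1)) : ℤ) (x (ι (l + (j + 1)))))
      rw [h2, h2] at h3
      have h4 : 0 < η ^ l * η ^ (j + 1) := by positivity
      nlinarith
    · have h1 : (1 - η)⁻¹ ≤ 2 := by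
        rw [inv_le_comm₀ (by linarith) (by norm_num)]; linarith
      have h2 : 0 < η ^ (j + 1) := by positivity
      nlinarith
  have hsplit := hgs.sum_add_tsum_nat_add (j + 1)
  rw [hg0, Finset.sum_range_succ] at hsplit
  have heq : g j = -(∑ l ∈ Finset.range j, g l) - ∑' l, g (l + (j + 1)) := by
    linear_combination hsplit
  have hmain : ‖g j‖ ≤ ∑ l ∈ Finset.range j, 7 * |M l * v (ι l) - round (M l * v (ι l))| +
      4 * η ^ (j + 1) := by
    rw [heq]
    refine (norm_sub_le _ _).trans (add_le_add ?_ htail)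
    rw [norm_neg]
    exact (norm_sum_le _ _).trans (Finset.sum_le_sum fun l _ => hup l)
  rw [← Finset.mul_sum] at hmain
  have hnn : 0 ≤ ∑ l ∈ Finset.range j, |M l * v (ι l) - round (M l * v (ι l))| :=
    Finset.sum_nonneg fun _ _ => abs_nonneg _
  linarith

lemma toralEndo_sub {d : ℕ} (A : Matrix (Fin d) (Fin d) ℤ) (x y : Fin d → UnitAddCircle) :
    toralEndo d A (y - x) = toralEndo d A y - toralEndo d A x := by
  funext i
  simp [toralEndo, smul_sub, Finset.sum_sub_distrib]

lemma toralEndo_coe {d : ℕ} (A : Matrix (Fin d) (Fin d) ℤ) (v : Fin d → ℝ) :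
    toralEndo d A (fun i => (v i : UnitAddCircle)) =
      fun i => (((A.map (Int.cast : ℤ → ℝ)).mulVec v i : ℝ) : UnitAddCircle) := by
  funext i
  simp only [toralEndo, Matrix.mulVec, dotProduct, Matrix.map_apply]
  rw [← QuotientAddGroup.mk'_apply, map_sum]
  refine Finset.sum_congr rfl fun j _ => ?_
  rw [QuotientAddGroup.mk'_apply, ← zsmul_eq_mul]
  rfl

lemma toralEndo_iterate_sub {d : ℕ} (A : Matrix (Fin d) (Fin d) ℤ) {x y : Fin d → UnitAddCircle}
    {κ : Fin d → ℝ} (hκ : (fun i => (κ i : UnitAddCircle)) = y - x) (n : ℕ) :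
    (fun i => ((((A.map (Int.cast : ℤ → ℝ)) ^ n).mulVec κ i : ℝ) : UnitAddCircle)) =
      (toralEndo d A)^[n] y - (toralEndo d A)^[n] x := by
  induction n with
  | zero => simpa using hκ
  | succ n ih =>
    rw [iterate_succ_apply', iterate_succ_apply', ← toralEndo_sub, ← ih, toralEndo_coe,
      Matrix.mulVec_mulVec, pow_succ']

/-- A hyperbolic toral endomorphism is observed by a continuous map to the plane. -/
lemma exists_planar_observable {d : ℕ} (hd : 0 < d) (A : Matrix (Fin d) (Fin d) ℤ)
    (hdet : A.det ≠ 0)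
    (hhyp : ∀ z : ℂ, ((A.map (Int.cast : ℤ → ℂ)).charpoly).IsRoot z → ‖z‖ ≠ 1) :
    ∃ f : C(Fin d → UnitAddCircle, EuclideanSpace ℝ (Fin 2)),
      ∀ x y : Fin d → UnitAddCircle, x ≠ y →
        ∃ n : ℕ, f ((toralEndo d A)^[n] x) ≠ f ((toralEndo d A)^[n] y) := by
  obtain ⟨η, hη, hη1, M, ι, hrigid⟩ := exists_rigid_scales hd A hdet hhyp
  let e := Complex.orthonormalBasisOneI.repr
  refine ⟨⟨fun x => e (lacunarySeries η M ι x),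
    e.continuous.comp (continuous_lacunarySeries hη hη1 M ι)⟩, fun x y hxy => ?_⟩
  by_contra! hcon
  choose κ hκ using fun i => QuotientAddGroup.mk_surjective (y i - x i)
  have hκ' : (fun i => (κ i : UnitAddCircle)) = y - x := funext hκ
  obtain ⟨z, hz⟩ := hrigid κ fun n j =>
    lacunarySeries_eq_imp hη hη1 (fun i => congrFun (toralEndo_iterate_sub A hκ' n) i)
      (e.injective (hcon n)) j
  refine hxy (sub_eq_zero.1 (funext fun i => ?_)).symm
  rw [← hκ', hz]
  exact (AddCircle.coe_eq_zero_iff (1 : ℝ)).2 ⟨z i, by simp⟩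

/-- The kernel of a non-invertible toral endomorphism contains a nonzero torsion element. -/
lemma exists_ne_zero_mem_ker {d : ℕ} (A : Matrix (Fin d) (Fin d) ℤ) (hdet : 1 < A.det.natAbs) :
    ∃ k : Fin d → UnitAddCircle, k ≠ 0 ∧ toralEndo d A k = 0 ∧ A.det.natAbs • k = 0 := by
  have hdet0 : A.det ≠ 0 := by intro h; simp [h] at hdet
  have hdetR : (A.det : ℝ) ≠ 0 := by exact_mod_cast hdet0
  have hint : ∀ m : ℤ, ((m : ℝ) : UnitAddCircle) = 0 := fun m =>
    (AddCircle.coe_eq_zero_iff (1 : ℝ)).2 ⟨m, by simp⟩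
  have hex : ∃ i j, ¬ A.det ∣ A.adjugate i j := by
    by_contra! hcon
    choose c hc using hcon
    have h1 : A.adjugate = A.det • Matrix.of c := by
      ext i j; simp [hc]
    have h2 := A.mul_adjugate
    rw [h1, Matrix.mul_smul] at h2
    have h3 : A * Matrix.of c = 1 := smul_right_injective _ hdet0 h2
    have h4 := congrArg Matrix.det h3
    rw [Matrix.det_mul, Matrix.det_one] at h4
    have := Int.isUnit_iff_natAbs_eq.1 (IsUnit.of_mul_eq_one _ h4)
    omega
  obtain ⟨i₀, j₀, hij⟩ := hex
  let v : Fin d → ℝ := fun i => (A.adjugate i j₀ : ℝ) / A.det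
  refine ⟨fun i => (v i : UnitAddCircle), fun h0 => hij ?_, ?_, ?_⟩
  · obtain ⟨n, hn⟩ := (AddCircle.coe_eq_zero_iff (1 : ℝ)).1 (congrFun h0 i₀)
    refine ⟨n, ?_⟩
    rw [zsmul_eq_mul, mul_one, eq_div_iff hdetR] at hn
    have : n * A.det = A.adjugate i₀ j₀ := by exact_mod_cast hn
    rw [← this, mul_comm]
  · rw [toralEndo_coe]
    funext i
    have h1 : (A.map (Int.cast : ℤ → ℝ)).mulVec v i = (((A * A.adjugate) i j₀ : ℤ) : ℝ) / A.det := by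
      simp [Matrix.mulVec, dotProduct, v, Matrix.mul_apply, Finset.sum_div, mul_div_assoc]
    rw [h1, A.mul_adjugate, Matrix.smul_apply, smul_eq_mul, Int.cast_mul, mul_div_cancel_left₀ _ hdetR]
    exact hint _
  · funext i
    have h1 : A.det.natAbs • v i = ((A.det.sign * A.adjugate i j₀ : ℤ) : ℝ) := by
      have h2 : ((A.det.natAbs : ℤ) : ℝ) = ((A.det.sign * A.det : ℤ) : ℝ) := by
        rw [Int.sign_mul_self_eq_natAbs]
      rw [nsmul_eq_mul, ← Int.cast_natCast, h2]
      simp only [v]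
      rw [Int.cast_mul, Int.cast_mul]
      field_simp
    have h3 : A.det.natAbs • (v i : UnitAddCircle) = ((A.det.natAbs • v i : ℝ) : UnitAddCircle) := rfl
    exact h3.trans (by rw [h1]; exact hint _)

lemma exists_translate_eq {G : Type*} [AddCommGroup G] [TopologicalSpace G] [ContinuousAdd G]
    [PreconnectedSpace G] (f : C(G, ℝ)) {k : G} {q : ℕ} (hq : 0 < q) (hk : q • k = 0) :
    ∃ x, f (x + k) = f x := by
  have hsum : ∑ j ∈ Finset.range q, (f ((j + 1) • k) - f (j • k)) = 0 := by
    rw [Finset.sum_range_sub (fun j => f (j • k)), hk, zero_smul, sub_self]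
  have hne : (Finset.range q).Nonempty := Finset.nonempty_range_iff.2 hq.ne'
  obtain ⟨a, -, ha⟩ := Finset.exists_le_of_sum_le hne
    (g := fun _ => (0 : ℝ)) (hsum.trans Finset.sum_const_zero.symm).le
  obtain ⟨b, -, hb⟩ := Finset.exists_le_of_sum_le hne
    (f := fun _ => (0 : ℝ)) (Finset.sum_const_zero.trans hsum.symm).le
  obtain ⟨x, hx⟩ := mem_range_of_exists_le_of_exists_ge
    (f := fun x => f (x + k) - f x) (c := 0) (by fun_prop)
    ⟨a • k, by simpa only [succ_nsmul] using ha⟩ ⟨b • k, by simpa only [succ_nsmul] using hb⟩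
  exact ⟨x, sub_eq_zero.1 hx⟩

lemma not_observes_real {d : ℕ} (A : Matrix (Fin d) (Fin d) ℤ) (hdet : 1 < A.det.natAbs)
    (f : C(Fin d → UnitAddCircle, ℝ)) :
    ¬ (∀ x y : Fin d → UnitAddCircle, x ≠ y →
      ∃ n : ℕ, f ((toralEndo d A)^[n] x) ≠ f ((toralEndo d A)^[n] y)) := by
  intro h
  obtain ⟨k, hk0, hTk, hk⟩ := exists_ne_zero_mem_ker A hdet
  obtain ⟨x, hx⟩ := exists_translate_eq f (by omega) hk
  obtain ⟨n, hn⟩ := h (x + k) x (by simpa using hk0)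
  have hT : toralEndo d A (x + k) = toralEndo d A x := by
    rw [← sub_eq_zero, ← toralEndo_sub, add_sub_cancel_left, hTk]
  cases n with
  | zero => exact hn hx
  | succ n => exact hn (by rw [iterate_succ_apply, iterate_succ_apply, hT])

/-- A non-invertible hyperbolic toral endomorphism (|det A| > 1, no eigenvalue of modulus
one) has observability number 2: some continuous `f : 𝕋^d → ℝ²` observes it, but no
continuous `f : 𝕋^d → ℝ` does. -/
theorem stmt9 (d : ℕ) (A : Matrix (Fin d) (Fin d) ℤ)
    (hdet : 1 < A.det.natAbs)
    (hhyp : ∀ z : ℂ, ((A.map (Int.cast : ℤ → ℂ)).charpoly).IsRoot z → ‖z‖ ≠ 1) :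
    obsNum (toralEndo d A) = 2 ∧
      (∃ f : C(Fin d → UnitAddCircle, EuclideanSpace ℝ (Fin 2)),
        ∀ x y : Fin d → UnitAddCircle, x ≠ y →
          ∃ n : ℕ, f ((toralEndo d A)^[n] x) ≠ f ((toralEndo d A)^[n] y)) ∧
      (∀ f : C(Fin d → UnitAddCircle, ℝ),
        ¬ (∀ x y : Fin d → UnitAddCircle, x ≠ y →
          ∃ n : ℕ, f ((toralEndo d A)^[n] x) ≠ f ((toralEndo d A)^[n] y))) := by
  have hdet0 : A.det ≠ 0 := by intro h; simp [h] at hdet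
  have hd : 0 < d := by
    rcases Nat.eq_zero_or_pos d with rfl | h
    · simp at hdet
    · exact h
  have hf := exists_planar_observable hd A hdet0 hhyp
  have hreal := not_observes_real A hdet
  refine ⟨le_antisymm (sInf_le ⟨2, rfl, by norm_num, hf⟩) (le_sInf ?_), hf, hreal⟩
  rintro _ ⟨k, rfl, hk, f, hfk⟩
  rcases hk.eq_or_lt with rfl | hk
  · refine absurd (fun x y hxy => ?_) (hreal ⟨fun x => f x 0, by fun_prop⟩)
    obtain ⟨n, hn⟩ := hfk x y hxy
    refine ⟨n, fun h => hn (PiLp.ext fun i => ?_)⟩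
    rw [Subsingleton.elim i 0]
    exact h
  · exact_mod_cast hk
end
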